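/- Let Γ be a finite simple graph and let H be a non-abelian subgroup of the right-angled Artin group A(Γ). Then every commensurating endomorphism φ : H →* H is an inner automorphism of H: there exists w ∈ H such that φ(h) = w * h * w⁻¹ for all h ∈ H. -/

import Mathlib

/-- The set of defining relators of the right-angled Artin group on `Γ`. -/
abbrev raagRels {V : Type*} (Γ : SimpleGraph V) : Set (FreeGroup V) :=
  {r | ∃ u v : V, Γ.Adj u v ∧
    r = FreeGroup.of u * FreeGroup.of v * (FreeGroup.of u)⁻¹ * (FreeGroup.of v)⁻¹}

/-- The right-angled Artin group associated to a simple graph `Γ`. -/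
abbrev RAAG {V : Type*} (Γ : SimpleGraph V) := PresentedGroup (raagRels Γ)

/-- `g` and `h` are commensurable in `G`: some nonzero power of `g` is conjugate
to a nonzero power of `h`. -/
def CommElem {G : Type*} [Group G] (g h : G) : Prop :=
  ∃ (z : G) (m n : ℤ), m ≠ 0 ∧ n ≠ 0 ∧ g ^ n = z * h ^ m * z⁻¹

namespace RaagComm
open FreeGroup List

section Words
variable {X : Type*}

theorem _root_.FreeGroup.IsReduced.of_isInfix {L L' : List (X × Bool)}
    (h : FreeGroup.IsReduced L) (h' : L' <:+: L) : FreeGroup.IsReduced L' := by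
  obtain ⟨A, B, rfl⟩ := h'
  exact List.IsChain.right_of_append (List.IsChain.left_of_append h)

theorem isCyclicallyReduced_iff_append_self {L : List (X × Bool)} :
    IsCyclicallyReduced L ↔ FreeGroup.IsReduced (L ++ L) := by
  rw [isCyclicallyReduced_iff, FreeGroup.IsReduced, FreeGroup.IsReduced, List.isChain_append]
  tauto

theorem IsCyclicallyReduced.of_append_comm {A B : List (X × Bool)}
    (h : IsCyclicallyReduced (A ++ B)) : IsCyclicallyReduced (B ++ A) := by
  rw [isCyclicallyReduced_iff_append_self]
  refine (h.flatten_replicate 3).isReduced.of_isInfix ⟨A, B, ?_⟩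
  simp [List.replicate_succ]

theorem IsCyclicallyReduced.isRotated {A B : List (X × Bool)}
    (h : IsCyclicallyReduced A) (hr : A ~r B) : IsCyclicallyReduced B := by
  obtain ⟨n, rfl⟩ := hr
  rw [List.rotate_eq_drop_append_take_mod]
  apply IsCyclicallyReduced.of_append_comm
  rwa [List.take_append_drop]

theorem mk_eq_mk_of_isReduced {A B : List (X × Bool)} (hA : FreeGroup.IsReduced A)
    (hB : FreeGroup.IsReduced B) (h : mk A = mk B) : A = B := by
  classical
  rw [← hA.reduce_eq, ← hB.reduce_eq]
  exact reduce.sound h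

theorem mk_append (A B : List (X × Bool)) : mk (A ++ B) = mk A * mk B := mul_mk.symm

theorem mk_cons' (a : X × Bool) (B : List (X × Bool)) : mk (a :: B) = mk [a] * mk B := by
  simp [mul_mk]

theorem mk_singleton_not (a : X) (b : Bool) : mk [(a, !b)] = (mk [(a, b)])⁻¹ := by
  simp [inv_mk, invRev]

theorem isReduced_invRev {L : List (X × Bool)} (h : FreeGroup.IsReduced L) :
    FreeGroup.IsReduced (invRev L) := by
  classical
  rw [isReduced_iff_reduce_eq, reduce_invRev, h.reduce_eq]

theorem isReduced_pair {a b : X × Bool} : FreeGroup.IsReduced [a, b] ↔ (a.1 = b.1 → a.2 = b.2) := by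
  simp [FreeGroup.IsReduced]

theorem isReduced_append_of_ne_nil {A B C : List (X × Bool)} (h1 : FreeGroup.IsReduced (A ++ B))
    (h2 : FreeGroup.IsReduced (B ++ C)) (hB : B ≠ []) : FreeGroup.IsReduced (A ++ B ++ C) :=
  IsReduced.append_overlap h1 h2 hB

theorem isRotated_of_conj (L : List (X × Bool)) : ∀ (C D : List (X × Bool)), FreeGroup.IsReduced L →
    IsCyclicallyReduced C → IsCyclicallyReduced D →
    mk C = mk L * mk D * (mk L)⁻¹ → C ~r D := by
  induction L using List.reverseRecOn with
  | nil =>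
    intro C D _ hC hD h
    have : mk C = mk D := by simpa [← one_eq_mk] using h
    rw [mk_eq_mk_of_isReduced hC.1 hD.1 this]
  | append_singleton L l ih =>
    intro C D hL hC hD h
    have hL' : FreeGroup.IsReduced L := hL.of_isInfix ⟨[], [l], by simp⟩
    obtain ⟨a, b⟩ := l
    by_cases h1 : ∃ D', D = (a, !b) :: D'
    · obtain ⟨D', rfl⟩ := h1
      have hr : ((a, !b) :: D') ~r (D' ++ [(a, !b)]) := ⟨1, by simp⟩
      refine (ih C (D' ++ [(a, !b)]) hL' hC (IsCyclicallyReduced.isRotated hD hr) ?_).trans hr.symm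
      rw [h, mk_append, mk_cons' (a, !b) D', mk_append, mk_singleton_not]
      group
    by_cases h2 : ∃ D', D = D' ++ [(a, b)]
    · obtain ⟨D', rfl⟩ := h2
      have hr : (D' ++ [(a, b)]) ~r ((a, b) :: D') :=
        List.IsRotated.symm ⟨1, by simp⟩
      refine (ih C ((a, b) :: D') hL' hC (IsCyclicallyReduced.isRotated hD hr) ?_).trans hr.symm
      rw [h, mk_append, mk_cons' (a, b) D', mk_append]
      group
    rcases eq_or_ne D [] with rfl | hD0
    · have : mk C = mk [] := by
        rw [h, ← one_eq_mk]; group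
      rw [mk_eq_mk_of_isReduced hC.1 (by simp) this]
    exfalso
    have e1 : FreeGroup.IsReduced ([(a, b)] ++ D) := by
      match D, hD0 with
      | (c, d) :: D', _ =>
        have : FreeGroup.IsReduced ([(a, b)] ++ [(c, d)]) := by
          rw [List.singleton_append, isReduced_pair]
          intro hac
          simp only at hac ⊢
          by_contra hbd
          apply h1
          refine ⟨D', ?_⟩
          subst hac
          congr
          revert hbd; cases b <;> cases d <;> simp
        simpa using isReduced_append_of_ne_nil this (C := D') (by simpa using hD.1) (by simp)
    have e2 : FreeGroup.IsReduced (D ++ [(a, !b)]) := by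
      obtain ⟨D', ⟨c, d⟩, rfl⟩ : ∃ D' x, D = D' ++ [x] :=
        ⟨D.dropLast, D.getLast hD0, (List.dropLast_append_getLast hD0).symm⟩
      have : FreeGroup.IsReduced ([(c, d)] ++ [(a, !b)]) := by
          rw [List.singleton_append, isReduced_pair]
          intro hac
          simp only at hac ⊢
          by_contra hbd
          apply h2
          refine ⟨D', ?_⟩
          subst hac
          congr
          revert hbd; cases b <;> cases d <;> simp
      exact isReduced_append_of_ne_nil hD.1 this (by simp)
    have e3 : FreeGroup.IsReduced (L ++ [(a, b)] ++ D ++ [(a, !b)] ++ invRev L) := by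
      have e4 : FreeGroup.IsReduced ([(a, !b)] ++ invRev L) := by
        have := isReduced_invRev hL
        simpa [invRev] using this
      refine isReduced_append_of_ne_nil ?_ e4 (by simp)
      refine isReduced_append_of_ne_nil ?_ e2 hD0
      exact isReduced_append_of_ne_nil hL e1 (by simp)
    have e5 : C = L ++ [(a, b)] ++ D ++ [(a, !b)] ++ invRev L := by
      apply mk_eq_mk_of_isReduced hC.1 e3
      rw [h]
      simp only [mk_append, mk_singleton_not, ← inv_mk]
      group
    subst e5
    rw [isCyclicallyReduced_iff_append_self] at hC
    cases L with
    | nil =>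
      have : FreeGroup.IsReduced [(a, !b), (a, b)] :=
        hC.of_isInfix ⟨[(a, b)] ++ D, D ++ [(a, !b)], by simp⟩
      rw [isReduced_pair] at this
      simp at this
    | cons x L =>
      obtain ⟨x, y⟩ := x
      have : FreeGroup.IsReduced [(x, !y), (x, y)] := hC.of_isInfix
        ⟨((x,y) :: L) ++ [(a, b)] ++ D ++ [(a, !b)] ++ invRev L,
          L ++ [(a, b)] ++ D ++ [(a, !b)] ++ invRev ((x,y) :: L), by simp [invRev]⟩
      rw [isReduced_pair] at this
      simp at this

end Words

section Torsion
variable {G : Type*} [Group G] [IsMulTorsionFree G]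

theorem commute_of_commute_zpow {a b : G} {n : ℤ} (hn : n ≠ 0) (h : Commute a (b ^ n)) :
    Commute a b := by
  have h1 : (a * b * a⁻¹) ^ n = b ^ n := by
    rw [conj_zpow, h.eq]; group
  have h2 := zpow_left_injective hn h1
  rw [Commute, SemiconjBy]
  exact mul_inv_eq_iff_eq_mul.mp h2

theorem commute_of_commute_pow {a b : G} {n : ℕ} (hn : n ≠ 0) (h : Commute a (b ^ n)) :
    Commute a b :=
  commute_of_commute_zpow (n := n) (by exact_mod_cast hn) (by simpa using h)

end Torsion

section Roots
variable {X : Type*}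

theorem freeGroup_exists_common_root {g h : FreeGroup X} (c : Commute g h) :
    ∃ (t : FreeGroup X) (i j : ℤ), g = t ^ i ∧ h = t ^ j := by
  classical
  let S := Subgroup.closure ({g, h} : Set (FreeGroup X))
  have hcomm : ∀ x y : S, x * y = y * x := by
    have : IsMulCommutative S := by
      apply Subgroup.isMulCommutative_closure
      rintro x (rfl | rfl) y (rfl | rfl)
      · rfl
      · exact c
      · exact c.symm
      · rfl
    exact fun x y => this.is_comm.comm x y
  have hsub : Subsingleton (IsFreeGroup.Generators S) := by
    constructor
    intro a b
    have h1 := hcomm ((IsFreeGroup.toFreeGroup S).symm (of a))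
      ((IsFreeGroup.toFreeGroup S).symm (of b))
    rw [← _root_.map_mul, ← _root_.map_mul] at h1
    have h2 := (IsFreeGroup.toFreeGroup S).symm.injective h1
    have h3 := congrArg toWord h2
    by_contra hab
    simp [of, mul_mk, toWord_mk, reduce] at h3
    exact hab h3.1
  have hcyc : IsCyclic S := by
    rcases isEmpty_or_nonempty (IsFreeGroup.Generators S) with he | hne
    · have : Subsingleton S := (IsFreeGroup.toFreeGroup S).toEquiv.subsingleton
      infer_instance
    · obtain ⟨u⟩ := hne
      have : Unique (IsFreeGroup.Generators S) := ⟨⟨u⟩, fun x => Subsingleton.elim _ _⟩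
      exact (MulEquiv.isCyclic ((IsFreeGroup.toFreeGroup S).trans mulEquivIntOfUnique)).mpr
        inferInstance
  obtain ⟨t, ht⟩ := hcyc
  obtain ⟨i, hi⟩ := ht ⟨g, Subgroup.subset_closure (by simp)⟩
  obtain ⟨j, hj⟩ := ht ⟨h, Subgroup.subset_closure (by simp)⟩
  refine ⟨t, i, j, ?_, ?_⟩
  · simpa using (congrArg Subtype.val hi).symm
  · simpa using (congrArg Subtype.val hj).symm

theorem freeGroup_commute_trans {a b c : FreeGroup X} (hb : b ≠ 1) (h1 : Commute a b)
    (h2 : Commute b c) : Commute a c := by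
  obtain ⟨t, i, j, rfl, rfl⟩ := freeGroup_exists_common_root h1
  have hj : j ≠ 0 := by rintro rfl; simp at hb
  have h3 : Commute t c := (commute_of_commute_zpow hj h2.symm).symm
  exact h3.zpow_left i

/-- Commuting nontrivial elements of a free group have a common nontrivial power. -/
theorem freeGroup_exists_common_power {a b : FreeGroup X} (ha : a ≠ 1) (hb : b ≠ 1)
    (h : Commute a b) : ∃ i j : ℤ, i ≠ 0 ∧ j ≠ 0 ∧ a ^ i = b ^ j := by
  obtain ⟨t, i, j, rfl, rfl⟩ := freeGroup_exists_common_root h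
  have hi : i ≠ 0 := by rintro rfl; simp at ha
  have hj : j ≠ 0 := by rintro rfl; simp at hb
  exact ⟨j, i, hj, hi, by rw [← zpow_mul, ← zpow_mul, mul_comm]⟩

theorem freeGroup_conj_inv_ne {c f : FreeGroup X} (hc : c ≠ 1) : f * c * f⁻¹ ≠ c⁻¹ := by
  intro h
  have hf : f * c = c⁻¹ * f := by rw [← h]; group
  have h2 : Commute (f ^ 2) c := by
    have h3 : f * c⁻¹ = c * f := by
      calc f * c⁻¹ = (f * c * f⁻¹)⁻¹ * f := by group
        _ = c * f := by rw [h, inv_inv]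
    rw [Commute, SemiconjBy, pow_two, mul_assoc, hf, ← mul_assoc, h3, mul_assoc]
  have h3 : Commute c f := commute_of_commute_pow two_ne_zero h2.symm
  rw [← h3.eq, mul_inv_cancel_right] at h
  have h4 : c ^ 2 = 1 ^ 2 := by
    rw [pow_two]; nth_rw 1 [h]; simp
  exact hc (pow_left_injective two_ne_zero h4)

end Roots

section CR
variable {X : Type*} [DecidableEq X]

/-- The reduced word of `g` is cyclically reduced. -/
def CR (g : FreeGroup X) : Prop := IsCyclicallyReduced g.toWord

theorem exists_conj_CR (g : FreeGroup X) : ∃ f c : FreeGroup X, CR c ∧ g = f * c * f⁻¹ := by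
  have hr := reduceCyclically.isCyclicallyReduced (isReduced_toWord (x := g))
  refine ⟨mk (reduceCyclically.conjugator g.toWord), mk (reduceCyclically g.toWord), ?_, ?_⟩
  · rw [CR, toWord_mk, hr.isReduced.reduce_eq]
    exact hr
  · rw [inv_mk, mul_mk, mul_mk, reduceCyclically.conj_conjugator_reduceCyclically, mk_toWord]

theorem CR.toWord_pow {c : FreeGroup X} (h : CR c) (n : ℕ) :
    (c ^ n).toWord = (List.replicate n c.toWord).flatten := by
  rw [FreeGroup.toWord_pow]
  exact (h.flatten_replicate n).isReduced.reduce_eq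

theorem CR.pow {c : FreeGroup X} (h : CR c) (n : ℕ) : CR (c ^ n) := by
  rw [CR, h.toWord_pow]
  exact h.flatten_replicate n

theorem CR.inv {c : FreeGroup X} (h : CR c) : CR c⁻¹ := by
  rw [CR, isCyclicallyReduced_iff_append_self] at *
  have := isReduced_invRev h
  simpa [toWord_inv, invRev_append] using this

theorem CR.zpow {c : FreeGroup X} (h : CR c) (n : ℤ) : CR (c ^ n) := by
  obtain ⟨k, rfl | rfl⟩ := n.eq_nat_or_neg
  · simpa using h.pow k
  · simpa using (h.pow k).inv

theorem CR.norm_pow {c : FreeGroup X} (h : CR c) (n : ℕ) : (c ^ n).norm = n * c.norm := by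
  simp [FreeGroup.norm, h.toWord_pow]

theorem CR.norm_zpow {c : FreeGroup X} (h : CR c) (n : ℤ) :
    (c ^ n).norm = n.natAbs * c.norm := by
  obtain ⟨k, rfl | rfl⟩ := n.eq_nat_or_neg
  · simpa using h.norm_pow k
  · simpa [norm_inv_eq] using h.norm_pow k

theorem CR.isRotated {c d f : FreeGroup X} (hc : CR c) (hd : CR d) (h : c = f * d * f⁻¹) :
    c.toWord ~r d.toWord := by
  apply isRotated_of_conj f.toWord _ _ isReduced_toWord hc hd
  simpa [mk_toWord] using h

theorem CR.norm_eq {c d f : FreeGroup X} (hc : CR c) (hd : CR d) (h : c = f * d * f⁻¹) :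
    c.norm = d.norm := (hc.isRotated hd h).perm.length_eq

theorem CR.conj_zpow_eq {c f : FreeGroup X} (hc : CR c) (h1 : c ≠ 1) {m n : ℤ}
    (hn : n ≠ 0) (h : f * c ^ m * f⁻¹ = c ^ n) : m = n ∧ Commute f c := by
  have h2 := (hc.zpow n).norm_eq (hc.zpow m) h.symm
  rw [hc.norm_zpow, hc.norm_zpow] at h2
  have h3 : c.norm ≠ 0 := by rwa [Ne, FreeGroup.norm_eq_zero]
  have h4 := Nat.eq_of_mul_eq_mul_right (Nat.pos_of_ne_zero h3) h2
  rcases Int.natAbs_eq_natAbs_iff.mp h4 with rfl | rfl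
  · refine ⟨rfl, ?_⟩
    apply commute_of_commute_zpow hn
    rw [Commute, SemiconjBy]
    exact mul_inv_eq_iff_eq_mul.mp h
  · exfalso
    have hm : m ≠ 0 := by simpa using hn
    refine freeGroup_conj_inv_ne (c := c ^ m) (f := f) ?_ (by rw [h]; simp)
    intro h5
    exact h1 (zpow_left_injective hm (by simpa using h5))

end CR

section Per
variable {α : Type*}

/-- The periodic sequence obtained by repeating the word `W`. -/
def per (W : List α) (i : ℕ) : Option α := W[i % W.length]?

theorem per_of_lt {W : List α} {i : ℕ} (h : i < W.length) : per W i = W[i]? := by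
  rw [per, Nat.mod_eq_of_lt h]

theorem per_add_length (W : List α) (i : ℕ) : per W (i + W.length) = per W i := by
  simp [per]

theorem per_mod (W : List α) (i : ℕ) : per W (i % W.length) = per W i := by
  simp [per]

theorem per_rotate (W : List α) (s i : ℕ) : per (W.rotate s) i = per W (i + s) := by
  rcases eq_or_ne W [] with rfl | hW
  · simp [per]
  have h0 : 0 < W.length := List.length_pos_iff.mpr hW
  rw [per, per, List.length_rotate, List.getElem?_rotate (Nat.mod_lt _ h0)]
  simp

theorem getElem?_flatten_replicate (w : List α) (k i : ℕ) (h : i < k * w.length) :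
    (replicate k w).flatten[i]? = per w i := by
  induction k generalizing i with
  | zero => simp at h
  | succ k ih =>
    rw [replicate_succ, flatten_cons]
    rcases lt_or_ge i w.length with h1 | h1
    · rw [List.getElem?_append_left h1, per_of_lt h1]
    · rw [List.getElem?_append_right h1, ih _ (by rw [add_mul] at h; omega)]
      conv_rhs => rw [← Nat.sub_add_cancel h1, per_add_length]

theorem per_flatten_replicate (w : List α) {k : ℕ} (hk : k ≠ 0) :
    per (replicate k w).flatten = per w := by
  funext i
  rcases eq_or_ne w [] with rfl | hw
  · simp [per]
  have h0 : 0 < w.length := List.length_pos_iff.mpr hw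
  have hl : (replicate k w).flatten.length = k * w.length := by simp
  rw [per, getElem?_flatten_replicate, per, per, hl, Nat.mod_mul_left_mod]
  rw [hl]
  exact Nat.mod_lt _ (by positivity)

theorem per_isRotated {A B : List α} (h : A ~r B) :
    ∃ s ≤ B.length, ∀ i, per A i = per B (i + s) := by
  obtain ⟨s, hs, rfl⟩ := List.isRotated_iff_mod.mp h.symm
  exact ⟨s, hs, fun i => per_rotate _ _ _⟩

theorem append_comm_of_periods {f : ℕ → Option α} {q w : List α}
    (hq : ∀ i < q.length, q[i]? = f i) (hw : ∀ i < w.length, w[i]? = f i)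
    (h1 : ∀ i < w.length, f (i + q.length) = f i) (h2 : ∀ i < q.length, f (i + w.length) = f i) :
    q ++ w = w ++ q := by
  have aux : ∀ (q w : List α) (_ : ∀ i < q.length, q[i]? = f i) (_ : ∀ i < w.length, w[i]? = f i)
      (_ : ∀ i < w.length, f (i + q.length) = f i) (i : ℕ) (_ : i < q.length + w.length),
      (q ++ w)[i]? = f i := by
    intro q w hq hw h1 i hi
    rcases lt_or_ge i q.length with h | h
    · rw [List.getElem?_append_left h, hq _ h]
    · rw [List.getElem?_append_right h, hw _ (by omega), ← h1 _ (by omega), Nat.sub_add_cancel h]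
  apply List.ext_getElem?
  intro i
  rcases lt_or_ge i (q.length + w.length) with h | h
  · rw [aux q w hq hw h1 i h, aux w q hw hq h2 i (by omega)]
  · rw [List.getElem?_eq_none (by simpa using h),
      List.getElem?_eq_none (by simp only [List.length_append]; omega)]

theorem append_comm_of_per_eq {A B : List α} (h : per A = per B) : A ++ B = B ++ A := by
  apply append_comm_of_periods (f := per A)
  · intro i hi; rw [per_of_lt hi]
  · intro i hi; rw [h, per_of_lt hi]
  · intro i _; rw [per_add_length]
  · intro i _; rw [h, per_add_length]

theorem per_run {w v : List α} {k i : ℕ} (h : i < k * w.length) :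
    per ((replicate k w).flatten ++ v) i = per w i := by
  have hl : i < (replicate k w).flatten.length := by simpa using h
  rw [per_of_lt (by rw [List.length_append]; omega), List.getElem?_append_left hl,
    getElem?_flatten_replicate _ _ _ h]

theorem per_eq_of_local {w : List α} {L : ℕ} (hw : w ≠ [])
    (h : ∀ i < w.length, per w (i + L) = per w i) (i : ℕ) : per w (i + L) = per w i := by
  have h0 : 0 < w.length := List.length_pos_iff.mpr hw
  rw [← per_mod w i, ← h _ (Nat.mod_lt _ h0), per, per]
  simp

theorem append_comm_of_run {w v : List α} {k L : ℕ} (hw : w ≠ []) (hL : 0 < L)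
    (hk : L + w.length ≤ k * w.length)
    (hper : ∀ i, per ((replicate k w).flatten ++ v) (i + L) =
      per ((replicate k w).flatten ++ v) i) :
    ((replicate k w).flatten ++ v) ++ w = w ++ ((replicate k w).flatten ++ v) := by
  have hwL : ∀ i, per w (i + L) = per w i := by
    apply per_eq_of_local hw
    intro i hi
    rw [← per_run (v := v) (k := k) (by omega), hper, per_run (by omega)]
  apply append_comm_of_per_eq
  funext i
  induction i using Nat.strong_induction_on with
  | _ i ih =>
    rcases lt_or_ge i L with h | h
    · exact per_run (by omega)
    · rw [← Nat.sub_add_cancel h, hper, hwL, ih _ (by omega)]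

theorem isRotated_of_per {A B : List α} (hl : A.length = B.length) {s : ℕ}
    (h : ∀ i < A.length, per A i = per B (i + s)) : A ~r B := by
  have : A = B.rotate s := by
    apply List.ext_getElem?
    intro i
    rcases lt_or_ge i A.length with hi | hi
    · rw [← per_of_lt hi, h i hi, ← per_rotate, per_of_lt (by simpa [← hl] using hi)]
    · rw [List.getElem?_eq_none hi, List.getElem?_eq_none (by simpa [← hl] using hi)]
  rw [this]
  exact List.IsRotated.symm ⟨s, rfl⟩

theorem align_aux {w w' v v' : List α} {N s : ℕ} (hw : w ≠ []) (hl : w.length = w'.length)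
    (hv : v.length = v'.length) (hN : v.length + 4 * w.length ≤ N * w.length)
    (hs : 2 * s ≤ ((replicate N w).flatten ++ v).length)
    (h : ∀ i, per ((replicate N w).flatten ++ v) i = per ((replicate N w').flatten ++ v') (i + s)) :
    w ~r w' ∧ (w = w' → ∃ q, q ++ w = w ++ q ∧
      ((replicate N w').flatten ++ v') ++ q = q ++ ((replicate N w).flatten ++ v)) := by
  have h0 : 0 < w.length := List.length_pos_iff.mpr hw
  simp only [List.length_append, List.length_flatten, List.map_replicate,
    List.sum_replicate, smul_eq_mul] at hs
  have key : ∀ i, i + s < N * w.length → per w i = per w' (i + s) := by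
    intro i hi
    rw [← per_run (v := v) (k := N) (by omega), h, per_run (by rwa [← hl])]
  refine ⟨isRotated_of_per hl fun i hi => key i (by omega), ?_⟩
  rintro rfl
  have hT : s ≤ ((replicate N w).flatten ++ v).length := by simp; omega
  set W := (replicate N w).flatten ++ v with hW
  set W' := (replicate N w).flatten ++ v' with hW'
  have hWl : W.length = W'.length := by simp [hW, hW', hv]
  have hqs : (W'.take s).length = s := by rw [List.length_take]; omega
  refine ⟨W'.take s, ?_, ?_⟩
  · apply append_comm_of_periods (f := per w)
    · intro i hi
      rw [hqs] at hi
      rw [List.getElem?_take_of_lt hi, ← per_of_lt (by omega), per_run (by omega)]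
    · intro i hi; rw [per_of_lt hi]
    · intro i hi
      rw [hqs, key i (by omega)]
    · intro i _; rw [per_add_length]
  · have : W = W'.rotate s := by
      apply List.ext_getElem?
      intro i
      rcases lt_or_ge i W.length with hi | hi
      · rw [← per_of_lt hi, h i, ← per_rotate, per_of_lt (by simpa [← hWl] using hi)]
      · rw [List.getElem?_eq_none hi, List.getElem?_eq_none (by simpa [← hWl] using hi)]
    rw [this, List.rotate_eq_drop_append_take (by omega), ← List.append_assoc,
      List.take_append_drop]

/-- If two cyclic words with long periodic runs are rotations of each other, the runs align. -/
theorem align {w w' v v' : List α} {N : ℕ} (hw : w ≠ []) (hl : w.length = w'.length)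
    (hv : v.length = v'.length) (hN : v.length + 4 * w.length ≤ N * w.length)
    (h : (replicate N w).flatten ++ v ~r (replicate N w').flatten ++ v') :
    w ~r w' ∧ (w = w' → ∃ q, q ++ w = w ++ q ∧
      (((replicate N w').flatten ++ v') ++ q = q ++ ((replicate N w).flatten ++ v) ∨
       ((replicate N w).flatten ++ v) ++ q = q ++ ((replicate N w').flatten ++ v'))) := by
  obtain ⟨s, hs, h1⟩ := per_isRotated h
  have hWl : ((replicate N w).flatten ++ v).length = ((replicate N w').flatten ++ v').length := by
    simp [hv, hl]
  rcases le_total (2 * s) ((replicate N w).flatten ++ v).length with h2 | h2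
  · obtain ⟨h3, h4⟩ := align_aux hw hl hv hN h2 h1
    exact ⟨h3, fun e => by obtain ⟨q, hq, hq'⟩ := h4 e; exact ⟨q, hq, Or.inl hq'⟩⟩
  · have hw' : w' ≠ [] := by
      rw [← List.length_pos_iff, ← hl, List.length_pos_iff]; exact hw
    obtain ⟨h3, h4⟩ := align_aux (s := ((replicate N w).flatten ++ v).length - s)
      hw' hl.symm hv.symm
      (by rw [← hv, ← hl]; exact hN) (by omega) (fun i => by
        rw [h1, add_assoc, Nat.sub_add_cancel (by omega), hWl, per_add_length])
    exact ⟨h3.symm, fun e => by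
      obtain ⟨q, hq, hq'⟩ := h4 e.symm; exact ⟨q, by rw [e]; exact hq, Or.inr hq'⟩⟩

end Per

section
variable {X : Type*}

theorem exists_cancel (A : List (X × Bool)) : ∀ B : List (X × Bool), FreeGroup.IsReduced A →
    FreeGroup.IsReduced B → ∃ A' C B', A = A' ++ C ∧ B = invRev C ++ B' ∧
      FreeGroup.IsReduced (A' ++ B') := by
  induction A using List.reverseRecOn with
  | nil => exact fun B _ hB => ⟨[], [], B, by simp, by simp, by simpa using hB⟩
  | append_singleton A l ih =>
    intro B hA hB
    obtain ⟨a, b⟩ := l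
    by_cases h : ∃ B1, B = (a, !b) :: B1
    · obtain ⟨B1, rfl⟩ := h
      obtain ⟨A', C, B', rfl, rfl, h3⟩ := ih B1 (hA.of_isInfix ⟨[], [(a, b)], by simp⟩)
        (hB.of_isInfix ⟨[(a, !b)], [], by simp⟩)
      exact ⟨A', C ++ [(a, b)], B', by simp, by simp [invRev], h3⟩
    · refine ⟨A ++ [(a, b)], [], B, by simp, by simp, ?_⟩
      match B with
      | [] => simpa using hA
      | (c, d) :: B1 =>
        have h1 : FreeGroup.IsReduced ([(a, b)] ++ (c, d) :: B1) := by
          have : FreeGroup.IsReduced ([(a, b)] ++ [(c, d)]) := by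
            rw [List.singleton_append, isReduced_pair]
            intro hac
            simp only at hac ⊢
            by_contra hbd
            apply h
            refine ⟨B1, ?_⟩
            subst hac
            congr
            revert hbd; cases b <;> cases d <;> simp
          simpa using isReduced_append_of_ne_nil this (C := B1) (by simpa using hB) (by simp)
        exact isReduced_append_of_ne_nil hA h1 (by simp)

variable [DecidableEq X]

theorem toWord_mul_cancel (a b : FreeGroup X) : ∃ A' C B', a.toWord = A' ++ C ∧
    b.toWord = invRev C ++ B' ∧ (a * b).toWord = A' ++ B' := by
  obtain ⟨A', C, B', h1, h2, h3⟩ := exists_cancel a.toWord b.toWord isReduced_toWord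
    isReduced_toWord
  refine ⟨A', C, B', h1, h2, ?_⟩
  rw [← h3.reduce_eq, ← toWord_mk]
  congr 1
  rw [← mk_toWord (x := a), ← mk_toWord (x := b), h1, h2, mk_append, mk_append, mk_append, ← inv_mk]
  group

theorem conj_of_isRotated {a b : FreeGroup X} (h : a.toWord ~r b.toWord) :
    ∃ f, a = f * b * f⁻¹ := by
  obtain ⟨s, _, h2⟩ := List.isRotated_iff_mod.mp h
  rw [List.rotate_eq_drop_append_take_mod] at h2
  refine ⟨mk (a.toWord.take (s % a.toWord.length)), ?_⟩
  rw [← mk_toWord (x := b), ← h2, mk_append]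
  calc a = mk (a.toWord.take (s % a.toWord.length)) * mk (a.toWord.drop (s % a.toWord.length)) := by
        rw [← mk_append, List.take_append_drop, mk_toWord]
    _ = _ := by group

/-- The word of `y` begins and ends with the word of `x`. -/
def Padded (x y : FreeGroup X) : Prop := x.toWord <+: y.toWord ∧ x.toWord <:+ y.toWord

theorem toWord_ne_nil {x : FreeGroup X} (h : x ≠ 1) : x.toWord ≠ [] := by
  rwa [Ne, toWord_eq_nil_iff]

theorem norm_pos' {x : FreeGroup X} (h : x ≠ 1) : 0 < x.norm := by
  rw [FreeGroup.norm, List.length_pos_iff]; exact toWord_ne_nil h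

theorem eventually_padded {x : FreeGroup X} (hx : CR x) (h1 : x ≠ 1) (y : FreeGroup X) :
    ∀ M, 2 * y.norm + 2 ≤ M → Padded x (x ^ M * y * x ^ M) := by
  intro M hM
  have hp : 0 < x.toWord.length := norm_pos' h1
  obtain ⟨Y, C, R, hY, hR, hYR⟩ := toWord_mul_cancel y (x ^ M)
  obtain ⟨A, D, B, hA, hB, hAB⟩ := toWord_mul_cancel (x ^ M) (y * x ^ M)
  rw [hYR] at hB
  rw [hx.toWord_pow] at hR hA
  have lY := congrArg List.length hY
  have lR := congrArg List.length hR
  have lA := congrArg List.length hA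
  have lB := congrArg List.length hB
  simp only [List.length_append, List.length_flatten, List.map_replicate, invRev_length,
    List.sum_replicate, smul_eq_mul] at lY lR lA lB
  have hn : y.norm = y.toWord.length := rfl
  have hM' : (2 * y.norm + 2) * x.toWord.length ≤ M * x.toWord.length := Nat.mul_le_mul_right _ hM
  have hMn : 2 * y.norm + 2 * x.toWord.length ≤ M * x.toWord.length := by nlinarith
  have hD : D.length < y.norm + x.toWord.length := by
    by_contra! hcon
    have hDi : ∀ i < D.length, (invRev D)[i]? = per (invRev x.toWord) i := by
      intro i hi
      have h2 : invRev D ++ invRev A = (replicate M (x⁻¹).toWord).flatten := by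
        rw [← invRev_append, ← hA, ← hx.toWord_pow, ← toWord_inv, ← inv_pow, hx.inv.toWord_pow]
      rw [← toWord_inv, ← getElem?_flatten_replicate _ M, ← h2,
        List.getElem?_append_left (by simpa using hi)]
      simp only [toWord_inv, invRev_length]; omega
    have key : ∀ j < x.toWord.length, per (invRev x.toWord) (j + y.norm) =
        per x.toWord (j + (y.norm - Y.length + C.length)) := by
      intro j hj
      rw [← hDi _ (by omega)]
      have h3 : (invRev D)[j + y.norm]? = (Y ++ R)[j + y.norm]? := by
        rw [hB, List.getElem?_append_left (by rw [invRev_length]; omega)]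
      rw [h3, List.getElem?_append_right (by omega),
        ← getElem?_flatten_replicate _ M _ (by omega), hR, List.getElem?_append_right (by
          rw [invRev_length]; omega)]
      congr 1
      rw [invRev_length]; omega
    have hrot : (invRev x.toWord).rotate y.norm ~r x.toWord := by
      apply isRotated_of_per (s := y.norm - Y.length + C.length) (by simp)
      intro i hi
      rw [per_rotate, key i (by simpa using hi)]
    have hrot2 : (x⁻¹).toWord ~r x.toWord := by
      rw [toWord_inv]
      exact List.IsRotated.trans ⟨_, rfl⟩ hrot
    obtain ⟨f, hf⟩ := conj_of_isRotated hrot2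
    exact freeGroup_conj_inv_ne h1 hf.symm
  have hMne : M ≠ 0 := by omega
  obtain ⟨k, rfl⟩ := Nat.exists_eq_succ_of_ne_zero hMne
  constructor
  · rw [mul_assoc, hAB]
    have h2 : x.toWord <+: A ++ D := by
      rw [← hA, replicate_succ, flatten_cons]; exact List.prefix_append _ _
    have h3 := List.prefix_of_prefix_length_le h2 (List.prefix_append A D) (by omega)
    exact h3.trans (List.prefix_append A B)
  · rw [mul_assoc, hAB]
    have h2 : x.toWord <:+ invRev C ++ R := by
      rw [← hR, replicate_succ', flatten_concat]; exact List.suffix_append _ _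
    have h3 := List.suffix_of_suffix_length_le h2 (List.suffix_append _ R) (by omega)
    have h4 : x.toWord <:+ invRev D ++ B := by
      rw [← hB]; exact h3.trans (List.suffix_append _ _)
    have h5 := List.suffix_of_suffix_length_le h4 (List.suffix_append _ B) (by omega)
    exact h5.trans (List.suffix_append _ _)

theorem Padded.ne_one {x y : FreeGroup X} (h1 : x ≠ 1) (h : Padded x y) : y ≠ 1 := by
  rintro rfl
  have := h.1
  simp at this
  exact h1 this

theorem Padded.reduced {x y : FreeGroup X} (hx : CR x) (h1 : x ≠ 1) (h : Padded x y) {N : ℕ}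
    (hN : N ≠ 0) :
    FreeGroup.IsReduced (((replicate N x.toWord).flatten ++ y.toWord) ++
      ((replicate N x.toWord).flatten ++ y.toWord)) := by
  have hy := toWord_ne_nil (h.ne_one h1)
  have hx0 := toWord_ne_nil h1
  have hyr := isReduced_toWord (x := y)
  have hxx := isCyclicallyReduced_iff_append_self.mp hx
  have e1 : FreeGroup.IsReduced (y.toWord ++ x.toWord) := by
    obtain ⟨v, hv⟩ := h.2
    rw [← hv] at hyr ⊢
    exact isReduced_append_of_ne_nil hyr hxx hx0
  have e2 : FreeGroup.IsReduced (x.toWord ++ y.toWord) := by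
    obtain ⟨v, hv⟩ := h.1
    rw [← hv] at hyr ⊢
    rw [← List.append_assoc]
    exact isReduced_append_of_ne_nil hxx hyr hx0
  have e3 := isReduced_append_of_ne_nil e1 e2 hx0
  have e4 := IsReduced.append_flatten_replicate_append hx e3 hN
  have e5 : FreeGroup.IsReduced ((replicate N x.toWord).flatten ++ y.toWord) :=
    e4.of_isInfix ⟨y.toWord, [], by simp⟩
  rw [List.append_assoc] at e4
  exact isReduced_append_of_ne_nil e5 e4 hy

theorem Padded.toWord_mul {x y : FreeGroup X} (hx : CR x) (h1 : x ≠ 1) (h : Padded x y) {N : ℕ}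
    (hN : N ≠ 0) : (x ^ N * y).toWord = (replicate N x.toWord).flatten ++ y.toWord := by
  have : FreeGroup.IsReduced ((replicate N x.toWord).flatten ++ y.toWord) :=
    (h.reduced hx h1 hN).of_isInfix ⟨[], (replicate N x.toWord).flatten ++ y.toWord, by simp⟩
  rw [FreeGroup.toWord_mul, hx.toWord_pow, this.reduce_eq]

theorem Padded.CR_mul {x y : FreeGroup X} (hx : CR x) (h1 : x ≠ 1) (h : Padded x y) {N : ℕ}
    (hN : N ≠ 0) : CR (x ^ N * y) := by
  rw [CR, isCyclicallyReduced_iff_append_self, h.toWord_mul hx h1 hN]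
  exact h.reduced hx h1 hN

end

section
variable {X : Type*} [DecidableEq X]

theorem exists_conj_CR_norm_le (g : FreeGroup X) :
    ∃ f c : FreeGroup X, CR c ∧ g = f * c * f⁻¹ ∧ c.norm ≤ g.norm := by
  have hr := reduceCyclically.isCyclicallyReduced (isReduced_toWord (x := g))
  have hcc := reduceCyclically.conj_conjugator_reduceCyclically g.toWord
  refine ⟨mk (reduceCyclically.conjugator g.toWord), mk (reduceCyclically g.toWord), ?_, ?_, ?_⟩
  · rw [CR, toWord_mk, hr.isReduced.reduce_eq]
    exact hr
  · rw [inv_mk, mul_mk, mul_mk, hcc, mk_toWord]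
  · refine norm_mk_le.trans ?_
    conv_rhs => rw [FreeGroup.norm, ← hcc]
    simp only [List.length_append]
    omega

theorem CR.norm_le {c g f : FreeGroup X} (hc : CR c) (h : c = f * g * f⁻¹) : c.norm ≤ g.norm := by
  obtain ⟨f', c', hc', h', hn⟩ := exists_conj_CR_norm_le g
  rw [hc.norm_eq (d := c') (f := f * f') hc' (by rw [h, h']; group)]
  exact hn

theorem toWord_congr (σ : Equiv.Perm X) (g : FreeGroup X) :
    (freeGroupCongr σ g).toWord = g.toWord.map (Prod.map σ id) := by
  have h : FreeGroup.IsReduced (g.toWord.map (Prod.map σ id)) := by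
    have := isReduced_toWord (x := g)
    rw [FreeGroup.IsReduced, List.isChain_map]
    refine this.imp ?_
    intro a b hab
    simpa using hab
  rw [← h.reduce_eq, ← toWord_mk]
  congr 1
  conv_lhs => rw [← mk_toWord (x := g)]
  rfl

theorem norm_congr (σ : Equiv.Perm X) (g : FreeGroup X) : (freeGroupCongr σ g).norm = g.norm := by
  rw [FreeGroup.norm, FreeGroup.norm, toWord_congr, List.length_map]

theorem CR.congr {c : FreeGroup X} (h : CR c) (σ : Equiv.Perm X) : CR (freeGroupCongr σ c) := by
  rw [CR, isCyclicallyReduced_iff_append_self] at *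
  rw [toWord_congr, ← List.map_append, FreeGroup.IsReduced, List.isChain_map]
  refine h.imp ?_
  intro a b hab
  simpa using hab

/-- Nonzero powers of `g` and of a letterwise permuted copy of `h` are conjugate. -/
def Sim (g h : FreeGroup X) : Prop :=
  ∃ (f : FreeGroup X) (σ : Equiv.Perm X) (a b : ℤ), a ≠ 0 ∧ b ≠ 0 ∧
    g ^ a = f * freeGroupCongr σ (h ^ b) * f⁻¹

theorem commute_of_sim_padded {x y h : FreeGroup X} (hx : CR x) (h1 : x ≠ 1) (hy : Padded x y)
    {k : ℕ} (hk : h.norm + x.norm ≤ k * x.norm) (hs : Sim (x ^ k * y) h) : Commute x y := by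
  have hxp := norm_pos' h1
  have hk0 : k ≠ 0 := by rintro rfl; omega
  have hcr := hy.CR_mul hx h1 hk0
  have hw := hy.toWord_mul hx h1 hk0
  have hu1 : x ^ k * y ≠ 1 := by
    intro h2
    rw [h2] at hw
    simp at hw
    exact hy.ne_one h1 hw.2
  obtain ⟨f, σ, a, b, ha, hb, hab⟩ := hs
  obtain ⟨f', c, hc, rfl, hn⟩ := exists_conj_CR_norm_le h
  obtain ⟨c', hc', a', b', ha', hb', f₁, hn', hab'⟩ : ∃ c', CR c' ∧ ∃ a' b' : ℕ, a' ≠ 0 ∧ b' ≠ 0 ∧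
      ∃ f₁, c'.norm = c.norm ∧ (x ^ k * y) ^ a' = f₁ * c' ^ b' * f₁⁻¹ := by
    have e1 : ∃ f₁, (x ^ k * y) ^ a = f₁ * (freeGroupCongr σ c) ^ b * f₁⁻¹ := by
      refine ⟨f * freeGroupCongr σ f', ?_⟩
      rw [hab, conj_zpow]
      simp only [_root_.map_mul, _root_.map_inv, map_zpow]
      group
    obtain ⟨f₁, e1⟩ := e1
    obtain ⟨a', rfl | rfl⟩ := a.eq_nat_or_neg <;> obtain ⟨b', rfl | rfl⟩ := b.eq_nat_or_neg
    · exact ⟨_, hc.congr σ, a', b', by simpa using ha, by simpa using hb, f₁, norm_congr _ _,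
        by simpa using e1⟩
    · exact ⟨_, (hc.congr σ).inv, a', b', by simpa using ha, by simpa using hb, f₁,
        by rw [norm_inv_eq, norm_congr], by simpa using e1⟩
    · refine ⟨_, (hc.congr σ).inv, a', b', by simpa using ha, by simpa using hb, f₁,
        by rw [norm_inv_eq, norm_congr], ?_⟩
      rw [← inv_inj, ← zpow_natCast, ← zpow_neg, e1]; simp [mul_assoc]
    · refine ⟨_, hc.congr σ, a', b', by simpa using ha, by simpa using hb, f₁,
        norm_congr _ _, ?_⟩
      rw [← inv_inj, ← zpow_natCast, ← zpow_neg, e1]; simp [mul_assoc]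
  have hrot := (hcr.pow a').isRotated (hc'.pow b') hab'
  rw [hcr.toWord_pow, hc'.toWord_pow, hw] at hrot
  obtain ⟨s, -, hper⟩ := per_isRotated hrot
  rw [per_flatten_replicate _ ha', per_flatten_replicate _ hb'] at hper
  have hc1 : c' ≠ 1 := by
    rintro rfl
    apply hu1
    apply pow_left_injective ha'
    simp [hab']
  have := append_comm_of_run (v := y.toWord) (toWord_ne_nil h1) (norm_pos' hc1)
    (k := k) (by simp only [FreeGroup.norm] at *; omega) (by
      intro i
      rw [hper, hper, add_right_comm]
      exact per_add_length _ _)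
  rw [← hw] at this
  have h5 := congrArg mk this
  rw [mk_append, mk_append, mk_toWord, mk_toWord] at h5
  have h6 : x ^ k * (y * x) = x ^ k * (x * y) := by
    rw [← mul_assoc, h5, ← mul_assoc, ← mul_assoc, ← pow_succ, ← pow_succ']
  exact (mul_left_cancel h6).symm

omit [DecidableEq X] in
theorem Sim.conj_left {g h : FreeGroup X} (hs : Sim g h) (f : FreeGroup X) :
    Sim (f * g * f⁻¹) h := by
  obtain ⟨f₁, σ, a, b, ha, hb, hab⟩ := hs
  exact ⟨f * f₁, σ, a, b, ha, hb, by rw [conj_zpow, hab]; group⟩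

omit [DecidableEq X] in
theorem commute_conj_pow {x y : FreeGroup X} {M : ℕ} (h : Commute x (x ^ M * y * x ^ M)) :
    Commute x y := by
  have h1 : x ^ M * (x * y) * x ^ M = x ^ M * (y * x) * x ^ M := by
    calc x ^ M * (x * y) * x ^ M = x * (x ^ M * y * x ^ M) := by
          rw [← mul_assoc, ← pow_succ, pow_succ']; simp only [mul_assoc]
      _ = (x ^ M * y * x ^ M) * x := h.eq
      _ = _ := by simp only [mul_assoc]; rw [← pow_succ, pow_succ']
  exact mul_left_cancel (mul_right_cancel h1)

theorem norm_le_of_sim {x y : FreeGroup X} (hx : CR x) (h1 : x ≠ 1) (hy : ¬ Commute x y) :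
    ∃ c : ℕ, ∀ (k : ℕ) (h : FreeGroup X), Sim (x ^ k * y) h → k * x.norm ≤ h.norm + c := by
  set M := 2 * y.norm + 2 with hM
  refine ⟨(2 * M + 1) * x.norm, fun k h hs => ?_⟩
  by_contra! hcon
  have hk : 2 * M ≤ k := by
    by_contra! hk
    have := Nat.mul_le_mul_right x.norm (show k ≤ 2 * M + 1 by omega)
    omega
  obtain ⟨j, rfl⟩ := Nat.exists_eq_add_of_le' hk
  refine hy (commute_conj_pow (M := M) (commute_of_sim_padded (k := j) (h := h) hx h1
    (eventually_padded hx h1 y M le_rfl) (by nlinarith) ?_))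
  have h3 : x ^ j * (x ^ M * y * x ^ M) = (x ^ M)⁻¹ * (x ^ (j + 2 * M) * y) * (x ^ M)⁻¹⁻¹ := by
    rw [inv_inv, ← mul_assoc, ← mul_assoc, ← mul_assoc, ← pow_add]
    congr 2
    rw [eq_inv_mul_iff_mul_eq, ← pow_add]
    congr 1
    omega
  rw [h3]
  exact hs.conj_left _

theorem exists_conj_of_align {x x₁ y y₁ f : FreeGroup X} (hx : CR x) (hx₁ : CR x₁) (h1 : x ≠ 1)
    (hl : x.norm = x₁.norm) (hy : Padded x y) (hy₁ : Padded x₁ y₁) {N : ℕ}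
    (hN : y.norm + 4 * x.norm ≤ N * x.norm) (h : x ^ N * y = f * (x₁ ^ N * y₁) * f⁻¹) :
    x.toWord ~r x₁.toWord ∧ (x = x₁ → ∃ q, Commute q x ∧ y = q * y₁ * q⁻¹) := by
  have hxp := norm_pos' h1
  have h11 : x₁ ≠ 1 := by rintro rfl; rw [FreeGroup.norm_one] at hl; omega
  have hN0 : N ≠ 0 := by rintro rfl; rw [zero_mul] at hN; omega
  have hrot := (hy.CR_mul hx h1 hN0).isRotated (hy₁.CR_mul hx₁ h11 hN0) h
  rw [hy.toWord_mul hx h1 hN0, hy₁.toWord_mul hx₁ h11 hN0] at hrot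
  have hv : y.toWord.length = y₁.toWord.length := by
    have := hrot.perm.length_eq
    simp only [FreeGroup.norm] at *
    simp only [List.length_append, List.length_flatten, List.map_replicate,
      List.sum_replicate, smul_eq_mul] at this
    rw [hl] at this
    omega
  obtain ⟨h2, h3⟩ := align (toWord_ne_nil h1) hl hv hN hrot
  refine ⟨h2, ?_⟩
  rintro rfl
  obtain ⟨q, hq, h4⟩ := h3 rfl
  have hq' : Commute (mk q) x := by
    have := congrArg mk hq
    rwa [mk_append, mk_append, mk_toWord] at this
  have e : ∀ {y z q : FreeGroup X}, Commute q x → (x ^ N * y) * q = q * (x ^ N * z) →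
      y * q = q * z := by
    intro y z q hq h
    have : x ^ N * (y * q) = x ^ N * (q * z) := by
      rw [← mul_assoc, h, ← mul_assoc, ← mul_assoc, (hq.pow_right N).eq]
    exact mul_left_cancel this
  rw [← hy.toWord_mul hx h1 hN0, ← hy₁.toWord_mul hx h1 hN0] at h4
  rcases h4 with h4 | h4
  · have := congrArg mk h4
    rw [mk_append, mk_append, mk_toWord, mk_toWord] at this
    have := e hq' this
    refine ⟨(mk q)⁻¹, hq'.inv_left, ?_⟩
    rw [mul_assoc, inv_inv, this]; group
  · have := congrArg mk h4
    rw [mk_append, mk_append, mk_toWord, mk_toWord] at this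
    have := e hq' this
    refine ⟨mk q, hq', ?_⟩
    rw [← this]; group

theorem exists_zpow_of_commute {x y : FreeGroup X} (hx : CR x) (h1 : x ≠ 1)
    (hy : ¬ Commute x y) : ∃ k₀ : ℕ, ∀ k ≥ k₀, ∀ e, Commute e (x ^ k * y) →
      ∃ j : ℤ, e = (x ^ k * y) ^ j := by
  obtain ⟨c, hc⟩ := norm_le_of_sim hx h1 hy
  have hxp := norm_pos' h1
  refine ⟨y.norm + 2 * c + 1, fun k hk e he => ?_⟩
  obtain ⟨t, i, j, rfl, hi⟩ := freeGroup_exists_common_root he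
  have hu : x ^ k * y ≠ 1 := by
    intro h2
    apply hy
    rw [mul_eq_one_iff_eq_inv'.mp h2]
    exact ((Commute.refl x).pow_right k).inv_right
  have hj0 : j ≠ 0 := by rintro rfl; simp at hi; exact hu hi
  obtain ⟨f, d, hd, rfl⟩ := exists_conj_CR t
  have hconj : d ^ j = f⁻¹ * (x ^ k * y) * f⁻¹⁻¹ := by
    rw [hi, conj_zpow]; group
  have e1 : j.natAbs * d.norm ≤ k * x.norm + y.norm := by
    rw [← hd.norm_zpow]
    refine ((hd.zpow j).norm_le hconj).trans ((FreeGroup.norm_mul_le _ _).trans ?_)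
    rw [hx.norm_pow]
  have e2 : k * x.norm ≤ d.norm + c := by
    refine hc k d ⟨f, 1, 1, j, one_ne_zero, hj0, ?_⟩
    have : freeGroupCongr (1 : Equiv.Perm X) (d ^ j) = d ^ j := by
      rw [show (1 : Equiv.Perm X) = Equiv.refl X from rfl, freeGroupCongr_refl]; rfl
    rw [this, hconj]; group
  have e3 : j.natAbs < 2 := by
    by_contra! h2
    have := Nat.mul_le_mul_right d.norm h2
    nlinarith
  have e4 : j = 1 ∨ j = -1 := by omega
  rcases e4 with rfl | rfl
  · exact ⟨i, by rw [hi, ← zpow_mul]; norm_num⟩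
  · exact ⟨-i, by rw [hi, ← zpow_mul]; norm_num⟩

end

/-- Unique roots, plus two constraints on how an element can be conjugate to a power of itself
or to an element commuting with it; these hold in all right-angled Artin groups. -/
structure Nice (A : Type*) [Group A] : Prop where
  torsionFree : IsMulTorsionFree A
  zpow_conj : ∀ (u z : A) (m n : ℤ), u ≠ 1 → m ≠ 0 → n ≠ 0 → u ^ n = z * u ^ m * z⁻¹ → n = m
  conj_commute : ∀ h z : A, Commute h (z * h * z⁻¹) → z * h * z⁻¹ = h

theorem Nice.of_injective {A C : Type*} [Group A] [Group C] (hA : Nice A) (f : C →* A)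
    (hf : Function.Injective f) : Nice C where
  torsionFree := by
    have := hA.torsionFree
    constructor
    intro n hn x y hxy
    apply hf
    apply pow_left_injective hn
    simpa using congrArg f hxy
  zpow_conj := by
    intro u z m n hu hm hn h
    refine hA.zpow_conj (f u) (f z) m n ?_ hm hn (by simpa using congrArg f h)
    simpa using (map_ne_one_iff f hf).mpr hu
  conj_commute := by
    intro h z hc
    apply hf
    simpa using hA.conj_commute (f h) (f z) (by simpa using hc.map f)

section
variable {X : Type*} [DecidableEq X]

/-- The letters occurring in the reduced word of `g`. -/
def supp (g : FreeGroup X) : Set X := {x | ∃ b, (x, b) ∈ g.toWord}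

theorem finite_supp (g : FreeGroup X) : (supp g).Finite := by
  refine (List.finite_toSet (g.toWord.map Prod.fst)).subset ?_
  rintro x ⟨b, hb⟩
  exact List.mem_map.mpr ⟨(x, b), hb, rfl⟩

theorem supp_mul (g h : FreeGroup X) : supp (g * h) ⊆ supp g ∪ supp h := by
  rintro x ⟨b, hb⟩
  rcases List.mem_append.mp ((toWord_mul_sublist g h).subset hb) with h | h
  · exact Or.inl ⟨b, h⟩
  · exact Or.inr ⟨b, h⟩

theorem supp_inv (g : FreeGroup X) : supp g⁻¹ = supp g := by
  ext x
  simp only [supp, Set.mem_ofPred_eq, toWord_inv, invRev, List.mem_reverse, List.mem_map]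
  constructor
  · rintro ⟨b, ⟨y, c⟩, h, h2⟩
    simp only [Prod.mk.injEq] at h2
    exact ⟨c, h2.1 ▸ h⟩
  · rintro ⟨b, h⟩
    exact ⟨!b, (x, b), h, rfl⟩

theorem supp_pow (g : FreeGroup X) (n : ℕ) : supp (g ^ n) ⊆ supp g := by
  induction n with
  | zero => rintro x ⟨b, hb⟩; simp at hb
  | succ n ih =>
    rw [pow_succ]
    exact (supp_mul _ _).trans (Set.union_subset ih le_rfl)

theorem CR.supp_pow {c : FreeGroup X} (hc : CR c) {n : ℕ} (hn : n ≠ 0) :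
    supp (c ^ n) = supp c := by
  ext x
  simp [supp, hc.toWord_pow, hn]

theorem CR.supp_zpow {c : FreeGroup X} (hc : CR c) {n : ℤ} (hn : n ≠ 0) :
    supp (c ^ n) = supp c := by
  obtain ⟨k, rfl | rfl⟩ := n.eq_nat_or_neg
  · rw [zpow_natCast]; exact hc.supp_pow (by simpa using hn)
  · rw [zpow_neg, supp_inv, zpow_natCast]; exact hc.supp_pow (by simpa using hn)

end

section
variable (B X : Type*) [Group B] [MulAction B X]

/-- The action on a free group induced by an action on its basis. -/
def act : B →* MulAut (FreeGroup X) where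
  toFun b := freeGroupCongr (MulAction.toPerm b)
  map_one' := by
    ext x
    induction x using FreeGroup.induction_on <;> simp_all
  map_mul' a b := by
    ext x
    induction x using FreeGroup.induction_on <;> simp_all [mul_smul]

/-- The semidirect product of a free group by a group permuting its basis. -/
abbrev SD := FreeGroup X ⋊[act B X] B

end

section
variable {B X : Type*} [Group B] [MulAction B X]

theorem act_of (b : B) (x : X) : act B X b (of x) = of (b • x) := by simp [act]

/-- Conjugation in `SD B X` restricted to the free normal subgroup. -/
def cj (z : SD B X) : MulAut (FreeGroup X) := MulAut.conj z.left * act B X z.right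

theorem cj_apply (z : SD B X) (u : FreeGroup X) :
    cj z u = z.left * act B X z.right u * z.left⁻¹ := rfl

open SemidirectProduct in
theorem inl_cj (z : SD B X) (u : FreeGroup X) : inl (cj z u) = z * inl u * z⁻¹ := by
  ext <;> simp [cj_apply]

open SemidirectProduct in
theorem cj_mul (z w : SD B X) (u : FreeGroup X) : cj (z * w) u = cj z (cj w u) := by
  apply inl_injective (φ := act B X)
  rw [inl_cj, inl_cj, inl_cj]; group

open SemidirectProduct in
theorem cj_inl (f u : FreeGroup X) : cj (inl f : SD B X) u = f * u * f⁻¹ := by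
  simp [cj_apply]

open SemidirectProduct in
theorem cj_eq_self_iff (z : SD B X) (u : FreeGroup X) :
    cj z u = u ↔ Commute z (inl u) := by
  rw [← (inl_injective (φ := act B X)).eq_iff, inl_cj, mul_inv_eq_iff_eq_mul]
  rfl

variable [DecidableEq X]

theorem act_norm (b : B) (u : FreeGroup X) : (act B X b u).norm = u.norm := norm_congr _ _

theorem CR.act {c : FreeGroup X} (h : CR c) (b : B) : CR (act B X b c) := h.congr _

theorem toWord_act (b : B) (u : FreeGroup X) :
    (act B X b u).toWord = u.toWord.map (Prod.map (b • ·) id) := toWord_congr _ _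

theorem mem_supp_act (b : B) (u : FreeGroup X) (x : X) :
    x ∈ supp (act B X b u) ↔ b⁻¹ • x ∈ supp u := by
  simp only [supp, toWord_act, Set.mem_ofPred_eq, List.mem_map, Prod.exists, Prod.map_apply, id_eq,
    Prod.mk.injEq]
  constructor
  · rintro ⟨b', a, c, h, rfl, rfl⟩
    exact ⟨c, by simpa using h⟩
  · rintro ⟨c, h⟩
    exact ⟨c, _, c, h, by simp, rfl⟩

theorem act_eq_self_iff (b : B) (u : FreeGroup X) :
    act B X b u = u ↔ ∀ x ∈ supp u, b • x = x := by
  have key : u.toWord.map (Prod.map (b • ·) id) = u.toWord ↔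
      ∀ a ∈ u.toWord, Prod.map (b • ·) id a = a := by
    conv_lhs => rhs; rw [← List.map_id u.toWord]
    rw [List.map_inj_left]
    rfl
  rw [← toWord_inj, toWord_act, key]
  constructor
  · rintro h x ⟨c, hc⟩
    simpa using h (x, c) hc
  · intro h
    rintro ⟨x, c⟩ hc
    simpa using h x ⟨c, hc⟩

/-- Elements fixing a point after taking a nonzero power already fix that point. -/
def RootClosed (B X : Type*) [Group B] [MulAction B X] : Prop :=
  ∀ (b : B) (n : ℤ) (x : X), n ≠ 0 → b ^ n • x = x → b • x = x

theorem act_eq_self_of_zpow (hrc : RootClosed B X) {b : B} {u : FreeGroup X} {n : ℤ} (hn : n ≠ 0)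
    (h : act B X (b ^ n) u = u) : act B X b u = u := by
  rw [act_eq_self_iff] at *
  exact fun x hx => hrc b n x hn (h x hx)

theorem act_eq_self_of_finite (hrc : RootClosed B X) {b : B} {u : FreeGroup X} {S : Set X}
    (hS : S.Finite) (h : ∀ N : ℕ, supp (act B X (b ^ N) u) ⊆ S) : act B X b u = u := by
  rw [act_eq_self_iff]
  intro x hx
  have h1 : ∀ N : ℕ, b ^ N • x ∈ S := fun N => h N (by rw [mem_supp_act]; simpa using hx)
  obtain ⟨i, -, j, -, hij, he⟩ := Set.infinite_univ.exists_ne_map_eq_of_mapsTo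
    (f := fun N : ℕ => b ^ N • x) (fun N _ => h1 N) hS
  refine hrc b ((j : ℤ) - i) x (by omega) ?_
  rw [sub_eq_neg_add, zpow_add, mul_smul, zpow_natCast, show b ^ j • x = b ^ i • x from he.symm,
    zpow_neg, zpow_natCast, inv_smul_smul]

theorem act_eq_self_of_twisted (hrc : RootClosed B X) {b : B} {g u v : FreeGroup X}
    (hu : act B X b u = u) (hv : act B X b v = v) (h : act B X b g = u⁻¹ * g * v) :
    act B X b g = g := by
  have key : ∀ N : ℕ, act B X (b ^ N) g = (u ^ N)⁻¹ * g * v ^ N := by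
    intro N
    induction N with
    | zero => simp
    | succ N ih =>
      rw [pow_succ', _root_.map_mul, MulAut.mul_apply, ih]
      simp only [_root_.map_mul, _root_.map_inv, map_pow, hu, hv, h]
      rw [pow_succ u, pow_succ' v]
      group
  refine act_eq_self_of_finite hrc (S := supp u ∪ supp g ∪ supp v)
    (((finite_supp _).union (finite_supp _)).union (finite_supp _)) (fun N => ?_)
  rw [key]
  refine (supp_mul _ _).trans (Set.union_subset_union ((supp_mul _ _).trans
    (Set.union_subset_union ?_ le_rfl)) (supp_pow _ _))
  rw [supp_inv]
  exact supp_pow _ _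

theorem supp_eq_of_isRotated {a c : FreeGroup X} (h : a.toWord ~r c.toWord) : supp a = supp c := by
  ext x
  simp only [supp, Set.mem_ofPred_eq, h.mem_iff]

theorem act_eq_self_of_supp_subset (hrc : RootClosed B X) {b : B} {c : FreeGroup X}
    (h : supp (act B X b c) ⊆ supp c) : act B X b c = c := by
  refine act_eq_self_of_finite hrc (finite_supp c) fun N => ?_
  induction N with
  | zero => simp
  | succ N ih =>
    intro x hx
    rw [pow_succ', _root_.map_mul, MulAut.mul_apply, mem_supp_act] at hx
    exact h ((mem_supp_act _ _ _).mpr (ih hx))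

theorem cj_zpow_eq (hrc : RootClosed B X) {c : FreeGroup X} (hc : CR c) (h1 : c ≠ 1)
    {z : SD B X} {m n : ℤ} (hm : m ≠ 0) (hn : n ≠ 0) (h : cj z (c ^ m) = c ^ n) :
    m = n ∧ Commute z.left c ∧ act B X z.right c = c := by
  rw [cj_apply] at h
  have hrot := (hc.zpow n).isRotated ((hc.zpow m).act z.right) h.symm
  have hs := supp_eq_of_isRotated hrot
  rw [map_zpow, hc.supp_zpow hn, (hc.act _).supp_zpow hm] at hs
  have h2 := act_eq_self_of_supp_subset hrc hs.symm.subset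
  rw [map_zpow, h2] at h
  obtain ⟨h3, h4⟩ := hc.conj_zpow_eq h1 hn h
  exact ⟨h3, h4, h2⟩

omit [DecidableEq X] in
theorem act_eq_self_of_commute {b : B} {c f : FreeGroup X} (hc : c ≠ 1) (h : Commute f c)
    (hb : act B X b c = c) : act B X b f = f := by
  rcases eq_or_ne f 1 with rfl | hf
  · simp
  obtain ⟨i, j, hi, hj, hij⟩ := freeGroup_exists_common_power hf hc h
  apply zpow_left_injective hi
  simp only
  rw [← map_zpow, hij, map_zpow, hb]

open SemidirectProduct in
theorem commute_inl_of_commute_zpow_CR (hrc : RootClosed B X) {t : FreeGroup X} (ht : CR t)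
    {x : SD B X} {n : ℤ} (hn : n ≠ 0) (h : Commute (x ^ n) (inl t)) : Commute x (inl t) := by
  rcases eq_or_ne t 1 with rfl | ht1
  · simp
  rw [← cj_eq_self_iff] at h
  obtain ⟨-, h1, h2⟩ := cj_zpow_eq hrc ht ht1 one_ne_zero one_ne_zero (by simpa using h)
  have hr : (x ^ n).right = x.right ^ n := map_zpow rightHom x n
  rw [hr] at h2
  have h3 := act_eq_self_of_zpow hrc hn h2
  have h4 := act_eq_self_of_commute ht1 h1 h3
  have h4' := act_eq_self_of_commute ht1 h1 h2
  have h5 : x.left * (x ^ n).left = (x ^ n).left * act B X (x.right ^ n) x.left := by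
    have := congrArg left (((Commute.refl x).zpow_right n).eq)
    rw [mul_left, mul_left, h4, hr] at this
    exact this
  have h6 := act_eq_self_of_twisted hrc (g := x.left) h4' h4' (by rw [mul_assoc, h5]; group)
  have h7 := act_eq_self_of_zpow hrc hn h6
  have h8 : Commute (inl x.left : SD B X) (inr x.right) := by
    rw [Commute, SemiconjBy]
    ext <;> simp [h7]
  have h9 : x = inl x.left * inr x.right := by ext <;> simp
  have h10 : (x ^ n).left = x.left ^ n := by
    conv_lhs => rw [h9, h8.mul_zpow, ← map_zpow, ← map_zpow, mul_left, left_inl, left_inr,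
      _root_.map_one, mul_one]
  rw [h10] at h1
  have h11 := commute_of_commute_zpow hn h1.symm
  rw [← cj_eq_self_iff, cj_apply, h3, ← h11.eq]
  simp

open SemidirectProduct in
theorem commute_inl_of_commute_zpow (hrc : RootClosed B X) {t : FreeGroup X}
    {x : SD B X} {n : ℤ} (hn : n ≠ 0) (h : Commute (x ^ n) (inl t)) : Commute x (inl t) := by
  obtain ⟨f, c, hc, rfl⟩ := exists_conj_CR t
  have key : ∀ y : SD B X, Commute y (inl (f * c * f⁻¹)) ↔
      Commute ((inl f)⁻¹ * y * (inl f)⁻¹⁻¹) (inl c) := by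
    intro y
    rw [← Commute.conj_iff (inl f)⁻¹]
    simp [mul_assoc]
  rw [key, ← conj_zpow] at h
  rw [key]
  exact commute_inl_of_commute_zpow_CR hrc hc hn h

open SemidirectProduct in
theorem not_conj_commute_CR (hrc : RootClosed B X) {h z : SD B X} {c : FreeGroup X}
    (hc : CR c) (h1 : c ≠ 1) (hcomm : Commute h (z * h * z⁻¹)) (he : z * h * z⁻¹ = inl c * h) :
    False := by
  have hch : Commute h (inl c) := by
    have : (inl c : SD B X) = (z * h * z⁻¹) * h⁻¹ := by rw [he]; group
    rw [this]
    exact hcomm.mul_right (Commute.refl h).inv_right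
  rw [← cj_eq_self_iff] at hch
  obtain ⟨-, h2, h3⟩ := cj_zpow_eq hrc hc h1 one_ne_zero one_ne_zero (by simpa using hch)
  have h4 := act_eq_self_of_commute h1 h2 h3
  have he' : inl c * h * z = z * h := by rw [← he]; group
  have hr : h.right * z.right = z.right * h.right := by
    simpa using congrArg right he'
  have hl : c * h.left * act B X h.right z.left = z.left * act B X z.right h.left := by
    simpa using congrArg left he'
  have h5 : act B X h.right (act B X z.right h.left) = act B X z.right h.left := by
    rw [← MulAut.mul_apply, ← _root_.map_mul, hr, _root_.map_mul, MulAut.mul_apply, h4]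
  have h6 : act B X h.right (c * h.left) = c * h.left := by rw [_root_.map_mul, h3, h4]
  have h7 := act_eq_self_of_twisted hrc (g := z.left) h6 h5 (by rw [mul_assoc, ← hl]; group)
  have h8 : cj z h.left = c * h.left := by
    rw [cj_apply, ← hl, h7]; group
  have hf : h.left ≠ 1 := by
    intro h0
    rw [h0, _root_.map_one, mul_one] at h8
    exact h1 h8.symm
  obtain ⟨a, e, ha, hee, hae⟩ := freeGroup_exists_common_power hf h1 h2
  have h9 : cj z (c ^ e) = c ^ (a + e) := by
    rw [← hae, map_zpow, h8, h2.symm.mul_zpow, hae, zpow_add]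
  rcases eq_or_ne (a + e) 0 with h0 | h0
  · rw [h0, zpow_zero, MulEquiv.map_eq_one_iff] at h9
    exact h1 (zpow_left_injective hee (by simpa using h9))
  · have := (cj_zpow_eq hrc hc h1 hee h0 h9).1
    omega

open SemidirectProduct in
omit [DecidableEq X] in
theorem right_pow (x : SD B X) (n : ℕ) : (x ^ n).right = x.right ^ n := map_pow rightHom x n

open SemidirectProduct in
omit [DecidableEq X] in
theorem right_zpow (x : SD B X) (n : ℤ) : (x ^ n).right = x.right ^ n :=
  map_zpow rightHom x n

open SemidirectProduct in
omit [DecidableEq X] in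
theorem eq_inl_of_right {x : SD B X} (h : x.right = 1) : x = inl x.left := by
  ext <;> simp [h]

open SemidirectProduct in
theorem Nice.semidirect (hB : Nice B) (hrc : RootClosed B X) : Nice (SD B X) where
  torsionFree := by
    have := hB.torsionFree
    constructor
    intro n hn x y hxy
    simp only at hxy
    have hr : x.right = y.right := by
      apply pow_left_injective hn
      simpa [right_pow] using congrArg rightHom hxy
    have ht := eq_inl_of_right (x := x⁻¹ * y) (by simp [hr])
    set t := (x⁻¹ * y).left
    have hy : y = x * inl t := by rw [← ht]; group
    have h1 : Commute (x ^ n) (inl t) := by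
      rw [← ht]
      refine Commute.mul_right ((Commute.refl x).pow_left n).inv_right ?_
      rw [hxy]
      exact (Commute.refl y).pow_left n
    have h2 : Commute x (inl t) := commute_inl_of_commute_zpow hrc (n := n) (by exact_mod_cast hn)
      (by simpa using h1)
    rw [hy, h2.mul_pow, left_eq_mul, ← map_pow, ← _root_.map_one (inl (φ := act B X)),
      inl_injective.eq_iff] at hxy
    have h3 : t = 1 := pow_left_injective hn (by simpa using hxy)
    rw [hy, h3, _root_.map_one, mul_one]
  zpow_conj := by
    intro u z m n hu hm hn h
    by_cases hr : u.right = 1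
    · rw [eq_inl_of_right hr] at hu h
      obtain ⟨f, c, hc, hfc⟩ := exists_conj_CR u.left
      rw [hfc] at hu h
      have h1 : c ≠ 1 := by rintro rfl; simp at hu
      have h2 : cj ((inl f)⁻¹ * z * inl f : SD B X) (c ^ m) = c ^ n := by
        apply inl_injective (φ := act B X)
        rw [inl_cj]
        simp only [_root_.map_mul, _root_.map_inv, map_zpow, conj_zpow] at h ⊢
        have h3 : (inl c : SD B X) ^ n = (inl f)⁻¹ * (inl f * inl c ^ n * (inl f)⁻¹) * inl f := by
          group
        rw [h3, h]
        group
      exact (cj_zpow_eq hrc hc h1 hm hn h2).1.symm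
    · exact hB.zpow_conj u.right z.right m n hr hm hn
        (by simpa [right_zpow] using congrArg rightHom h)
  conj_commute := by
    intro h z hcomm
    have hr := hB.conj_commute h.right z.right (by simpa using hcomm.map rightHom)
    have hc := eq_inl_of_right (x := z * h * z⁻¹ * h⁻¹) (by simp [hr])
    obtain ⟨f, c, hcr, hfc⟩ := exists_conj_CR (z * h * z⁻¹ * h⁻¹).left
    rw [hfc] at hc
    rcases eq_or_ne c 1 with rfl | h1
    · rw [mul_one, mul_inv_cancel, _root_.map_one, mul_inv_eq_one] at hc
      exact hc
    exfalso
    refine not_conj_commute_CR hrc (h := (inl f)⁻¹ * h * inl f) (z := (inl f)⁻¹ * z * inl f) hcr h1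
      ?_ ?_
    · have := (Commute.conj_iff (inl f)⁻¹).mpr hcomm
      rw [inv_inv] at this
      rw [show (inl f)⁻¹ * z * inl f * ((inl f)⁻¹ * h * inl f) * ((inl f)⁻¹ * z * inl f)⁻¹ =
        (inl f)⁻¹ * (z * h * z⁻¹) * inl f by group]
      exact this
    · rw [mul_inv_eq_iff_eq_mul] at hc
      calc _ = (inl f)⁻¹ * (z * h * z⁻¹) * inl f := by group
        _ = _ := by rw [hc]; simp; group

end

theorem commElem_conj_left {H : Type*} [Group H] {g h : H} (hc : CommElem g h) (w : H) :
    CommElem (w * g * w⁻¹) h := by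
  obtain ⟨z, m, n, hm, hn, h1⟩ := hc
  exact ⟨w * z, m, n, hm, hn, by rw [conj_zpow, h1]; group⟩

/-- The endomorphism `h ↦ w * φ h * w⁻¹`. -/
def conjEnd {H : Type*} [Group H] (w : H) (φ : H →* H) : H →* H :=
  (MulAut.conj w).toMonoidHom.comp φ

theorem conjEnd_apply {H : Type*} [Group H] (w : H) (φ : H →* H) (h : H) :
    conjEnd w φ h = w * φ h * w⁻¹ := rfl

theorem commElem_conjEnd {H : Type*} [Group H] {φ : H →* H} (hφ : ∀ h, CommElem (φ h) h) (w : H) :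
    ∀ h, CommElem (conjEnd w φ h) h := fun h => commElem_conj_left (hφ h) w

theorem injective_of_commElem {H : Type*} [Group H] [IsMulTorsionFree H] {φ : H →* H}
    (hφ : ∀ h, CommElem (φ h) h) : Function.Injective φ := by
  rw [injective_iff_map_eq_one]
  intro h h0
  obtain ⟨z, m, n, hm, hn, h1⟩ := hφ h
  rw [h0, one_zpow, eq_comm, mul_inv_eq_one, mul_eq_left] at h1
  exact zpow_left_injective hm (by simpa using h1)

theorem commute_map_iff {H G : Type*} [Group H] [Group G] {f : H →* G} (hf : Function.Injective f)
    {a b : H} : Commute (f a) (f b) ↔ Commute a b := by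
  rw [Commute, SemiconjBy, ← _root_.map_mul, ← _root_.map_mul, hf.eq_iff]; rfl

section
variable {X : Type*}

theorem Sim.symm {g h : FreeGroup X} (hs : Sim g h) : Sim h g := by
  obtain ⟨f, σ, a, b, ha, hb, hab⟩ := hs
  refine ⟨(freeGroupCongr σ).symm f⁻¹, σ.symm, b, a, hb, ha, ?_⟩
  rw [← freeGroupCongr_symm, hab]
  simp only [_root_.map_mul, _root_.map_inv, MulEquiv.symm_apply_apply]
  group

end

section
variable {B X H : Type*} [Group B] [MulAction B X] [Group H] {ι : H →* SD B X}

open SemidirectProduct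

theorem map_commElem_left [IsMulTorsionFree B] {φ : H →* H} (hφ : ∀ h, CommElem (φ h) h) {k : H}
    {Y : FreeGroup X} (hk : ι k = inl Y) : ∃ Y', ι (φ k) = inl Y' := by
  refine ⟨_, eq_inl_of_right ?_⟩
  obtain ⟨z, m, n, hm, hn, h1⟩ := hφ k
  have h2 := congrArg (fun t => (ι t).right) h1
  simp only [_root_.map_mul, map_zpow, right_zpow, hk, _root_.map_inv, mul_right, right_inl,
    one_zpow, mul_one, inv_right, mul_inv_cancel] at h2
  exact zpow_left_injective hn (by simpa using h2)

theorem sim_of_commElem {a k : H} {Y Y' : FreeGroup X} (h : CommElem a k) (hk : ι k = inl Y)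
    (ha : ι a = inl Y') : Sim Y' Y := by
  obtain ⟨z, m, n, hm, hn, h1⟩ := h
  refine ⟨(ι z).left, MulAction.toPerm (ι z).right, n, m, hn, hm, ?_⟩
  have h2 := congrArg ι h1
  rw [_root_.map_mul, _root_.map_mul, map_zpow, map_zpow, _root_.map_inv, ha, hk, ← map_zpow,
    ← map_zpow, ← inl_cj, inl_injective.eq_iff] at h2
  exact h2

theorem le_of_forall_mul_le {a b L c : ℕ} (hL : 0 < L) (h : ∀ N : ℕ, a * N * L ≤ b * N * L + c) :
    a ≤ b := by
  by_contra! hlt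
  have h1 := h (c + 1)
  have h2 : (b + 1) * (c + 1) * L ≤ a * (c + 1) * L :=
    Nat.mul_le_mul_right _ (Nat.mul_le_mul_right _ hlt)
  nlinarith

variable [DecidableEq X]

theorem exists_conj_sign (hB : Nice B) (hrc : RootClosed B X) (hι : Function.Injective ι)
    {φ : H →* H} (hφ : ∀ h, CommElem (φ h) h) {x y : H} {P Q : FreeGroup X}
    (hx : ι x = inl P) (hy : ι y = inl Q) (hP : CR P) (h1 : P ≠ 1) (hPQ : ¬ Commute P Q) :
    ∃ (z : H) (ε : ℤ), (ε = 1 ∨ ε = -1) ∧ φ x = z * x ^ ε * z⁻¹ := by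
  have hH : Nice H := (hB.semidirect hrc).of_injective ι hι
  have := hH.torsionFree
  have := hB.torsionFree
  obtain ⟨z, m, n, hm, hn, hz⟩ : ∃ (z : H) (m : ℤ) (n : ℕ), m ≠ 0 ∧ n ≠ 0 ∧
      φ x ^ n = z * x ^ m * z⁻¹ := by
    obtain ⟨z, m, n, hm, hn, h⟩ := hφ x
    obtain ⟨n', rfl | rfl⟩ := n.eq_nat_or_neg
    · exact ⟨z, m, n', hm, by simpa using hn, by simpa using h⟩
    · refine ⟨z, -m, n', by simpa using hm, by simpa using hn, ?_⟩
      rw [zpow_neg, zpow_natCast, inv_eq_iff_eq_inv] at h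
      rw [h]; group
  obtain ⟨ε, M, hε, hM⟩ : ∃ (ε : ℤ) (M : ℕ), (ε = 1 ∨ ε = -1) ∧ m = ε * M := by
    obtain ⟨M, h | h⟩ := m.eq_nat_or_neg
    · exact ⟨1, M, Or.inl rfl, by simpa using h⟩
    · exact ⟨-1, M, Or.inr rfl, by simpa using h⟩
  refine ⟨z, ε, hε, ?_⟩
  set ψ := conjEnd z⁻¹ φ with hψ
  have hψc := commElem_conjEnd hφ z⁻¹
  have hψi := injective_of_commElem hψc
  have e1 : ψ x ^ n = (x ^ ε) ^ M := by
    rw [hψ, conjEnd_apply, conj_pow, hz, hM, zpow_mul, zpow_natCast]; group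
  have hε0 : ε ≠ 0 := by rcases hε with rfl | rfl <;> norm_num
  obtain ⟨Q', hQ'⟩ := map_commElem_left (ι := ι) hψc hy
  have hP' : ι (x ^ ε) = inl (P ^ ε) := by rw [map_zpow, hx, map_zpow]
  have hnorm : (P ^ ε).norm = P.norm := by
    rw [hP.norm_zpow]; rcases hε with rfl | rfl <;> simp
  have hP1 : P ^ ε ≠ 1 := fun h => h1 (zpow_left_injective hε0 (by simpa using h))
  have hPQ' : ¬ Commute (P ^ ε) Q' := by
    intro h
    rw [← commute_map_iff (inl_injective (φ := act B X)), ← hP', ← hQ', commute_map_iff hι] at h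
    have h2 : Commute (ψ x) (ψ y) := by
      have h3 := h.pow_left M
      rw [← e1] at h3
      exact (commute_of_commute_pow hn h3.symm).symm
    rw [commute_map_iff hψi, ← commute_map_iff hι, hx, hy, commute_map_iff inl_injective] at h2
    exact hPQ h2
  have hu : ∀ N : ℕ, ι (x ^ (n * N) * y) = inl (P ^ (n * N) * Q) := by
    intro N; simp [hx, hy]
  have hu' : ∀ N : ℕ, ι (ψ (x ^ (n * N) * y)) = inl ((P ^ ε) ^ (M * N) * Q') := by
    intro N
    rw [_root_.map_mul, map_pow, pow_mul, e1, ← pow_mul, _root_.map_mul, map_pow, hP', hQ']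
    simp
  have hsim : ∀ N : ℕ, Sim ((P ^ ε) ^ (M * N) * Q') (P ^ (n * N) * Q) := fun N =>
    sim_of_commElem (hψc _) (hu N) (hu' N)
  obtain ⟨c, hc⟩ := norm_le_of_sim hP h1 hPQ
  obtain ⟨c', hc'⟩ := norm_le_of_sim (hP.zpow ε) hP1 hPQ'
  have hL := norm_pos' h1
  have i1 : n ≤ M := le_of_forall_mul_le hL (c := Q'.norm + c) fun N => by
    have h3 := hc (n * N) _ (hsim N).symm
    have h4 := FreeGroup.norm_mul_le ((P ^ ε) ^ (M * N)) Q'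
    rw [(hP.zpow ε).norm_pow, hnorm] at h4
    omega
  have i2 : M ≤ n := le_of_forall_mul_le hL (c := Q.norm + c') fun N => by
    have h3 := hc' (M * N) _ (hsim N)
    have h4 := FreeGroup.norm_mul_le (P ^ (n * N)) Q
    rw [hP.norm_pow] at h4
    rw [hnorm] at h3
    omega
  obtain rfl := le_antisymm i1 i2
  have e2 : ψ x = x ^ ε := pow_left_injective hn e1
  rw [← e2, hψ, conjEnd_apply]
  group

/-- `x` is mapped to a cyclically reduced element of the free factor whose letters are moved by
everything that does not centralize the part of `H` lying in the free factor. -/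
structure Base (ι : H →* SD B X) (x : H) (P : FreeGroup X) : Prop where
  map_eq : ι x = inl P
  cr : CR P
  ne_one : P ≠ 1
  generic : ∀ b, act B X b P = P → ∀ k Y, ι k = inl Y → act B X b Y = Y

theorem Padded.act {P Y : FreeGroup X} (h : Padded P Y) (b : B) :
    Padded (act B X b P) (act B X b Y) := by
  simp only [Padded, toWord_act]
  exact ⟨h.1.map _, h.2.map _⟩

theorem Padded.inv {P Y : FreeGroup X} (h : Padded P Y) : Padded P⁻¹ Y⁻¹ := by
  simp only [Padded, toWord_inv]
  obtain ⟨⟨a, ha⟩, ⟨b, hb⟩⟩ := h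
  constructor
  · rw [← hb, invRev_append]; exact List.prefix_append _ _
  · rw [← ha, invRev_append]; exact List.suffix_append _ _

omit [DecidableEq X] in
theorem Padded.not_commute {P Y : FreeGroup X} {N : ℕ} (h : ¬ Commute P Y) :
    ¬ Commute P (P ^ N * Y) := by
  intro h2
  apply h
  have := ((Commute.refl P).pow_right N).inv_right.mul_right h2
  simpa using this

theorem Base.mul {x y : H} {P Y : FreeGroup X} (hx : Base ι x P) (hy : ι y = inl Y)
    (h : Padded P Y) {N : ℕ} (hN : N ≠ 0) : Base ι (x ^ N * y) (P ^ N * Y) where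
  map_eq := by simp [hx.map_eq, hy]
  cr := h.CR_mul hx.cr hx.ne_one hN
  ne_one := by
    intro h2
    have := h.toWord_mul hx.cr hx.ne_one hN
    rw [h2] at this
    simp at this
    exact h.ne_one hx.ne_one this.2
  generic := by
    intro b hb
    apply hx.generic
    rw [act_eq_self_iff] at *
    rintro a ⟨c, hac⟩
    apply hb
    refine ⟨c, ?_⟩
    rw [h.toWord_mul hx.cr hx.ne_one hN, List.mem_append]
    left
    simp [hN, hac]

theorem Base.zpow {x : H} {P : FreeGroup X} (hx : Base ι x P) {n : ℤ} (hn : n ≠ 0) :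
    Base ι (x ^ n) (P ^ n) where
  map_eq := by simp [hx.map_eq]
  cr := hx.cr.zpow n
  ne_one := fun h => hx.ne_one (zpow_left_injective hn (by simpa using h))
  generic := by
    intro b hb
    apply hx.generic
    rw [map_zpow] at hb
    exact zpow_left_injective hn hb

end

section
variable {B X H : Type*} [Group B] [MulAction B X] [Group H] {ι : H →* SD B X} [DecidableEq X]

open SemidirectProduct

theorem Base.of_commute (hrc : RootClosed B X) {x z : H} {P : FreeGroup X} (hx : Base ι x P)
    (h : Commute z x) : Commute (ι z).left P ∧ ∀ k Y, ι k = inl Y → act B X (ι z).right Y = Y := by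
  have h1 : Commute (ι z) (inl P) := by rw [← hx.map_eq]; exact h.map ι
  rw [← cj_eq_self_iff] at h1
  obtain ⟨-, h2, h3⟩ := cj_zpow_eq hrc hx.cr hx.ne_one one_ne_zero one_ne_zero (by simpa using h1)
  exact ⟨h2, hx.generic _ h3⟩

theorem Base.exists_conj_of_padded (hB : Nice B) (hrc : RootClosed B X)
    (hι : Function.Injective ι) {φ : H →* H} (hφ : ∀ h, CommElem (φ h) h) {x y : H}
    {P Y Y' : FreeGroup X} (hx : Base ι x P) (hy : ι y = inl Y) (hPY : ¬ Commute P Y)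
    (hp : Padded P Y) {ε : ℤ} (hε : ε = 1 ∨ ε = -1) (hφx : φ x = x ^ ε) (hy' : ι (φ y) = inl Y')
    (hp' : Padded (P ^ ε) Y') : ∃ w, Commute w x ∧ φ y = w * y ^ ε * w⁻¹ := by
  have hinj := inl_injective (φ := act B X)
  have hP := hx.cr
  have h1 := hx.ne_one
  obtain ⟨k₁, hk₁⟩ := exists_zpow_of_commute hP h1 hPY
  obtain ⟨k₂, hk₂⟩ := exists_zpow_of_commute hP.inv (inv_ne_one.mpr h1)
    (y := Y⁻¹) (by rwa [Commute.inv_inv_iff])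
  set N := k₁ + k₂ + Y'.norm + 5 with hN
  have hN0 : N ≠ 0 := by omega
  have hu := hx.mul hy hp hN0
  obtain ⟨z, δ, hδ, hz⟩ := exists_conj_sign hB hrc hι hφ hu.map_eq hx.map_eq hu.cr hu.ne_one
    (fun h => Padded.not_commute hPY h.symm)
  obtain ⟨z', hz'⟩ : ∃ z', φ (x ^ N * y) = z' * ((x ^ δ) ^ N * y ^ δ) * z'⁻¹ := by
    rcases hδ with rfl | rfl
    · exact ⟨z, by simpa using hz⟩
    · refine ⟨z * x ^ N, ?_⟩
      rw [hz]
      simp only [zpow_neg, zpow_one, inv_pow, mul_inv_rev]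
      group
  have hU : ι ((x ^ δ) ^ N * y ^ δ) = inl ((P ^ δ) ^ N * Y ^ δ) := by simp [hx.map_eq, hy]
  have hroot : ∀ e, Commute e ((P ^ δ) ^ N * Y ^ δ) → ∃ j : ℤ, e = ((P ^ δ) ^ N * Y ^ δ) ^ j := by
    rcases hδ with rfl | rfl
    · simpa using hk₁ N (by omega)
    · simpa using hk₂ N (by omega)
  have hpδ : Padded (P ^ δ) (Y ^ δ) := by
    rcases hδ with rfl | rfl
    · simpa using hp
    · simpa using hp.inv
  have hε0 : ε ≠ 0 := by rcases hε with rfl | rfl <;> norm_num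
  have hδ0 : δ ≠ 0 := by rcases hδ with rfl | rfl <;> norm_num
  have hεn : (P ^ ε).norm = P.norm := by
    rw [hP.norm_zpow]; rcases hε with rfl | rfl <;> simp
  have hδn : (P ^ δ).norm = P.norm := by
    rw [hP.norm_zpow]; rcases hδ with rfl | rfl <;> simp
  set d := (ι z').right with hd
  set f := (ι z').left with hf
  have e1 : (P ^ ε) ^ N * Y' = f * ((act B X d (P ^ δ)) ^ N * act B X d (Y ^ δ)) * f⁻¹ := by
    have e2 : ι (φ (x ^ N * y)) = inl ((P ^ ε) ^ N * Y') := by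
      rw [_root_.map_mul, map_pow, hφx]; simp [hx.map_eq, hy']
    have e3 := congrArg ι hz'
    rw [e2, _root_.map_mul ι, _root_.map_mul ι, _root_.map_inv, hU, ← inl_cj, hinj.eq_iff] at e3
    rw [e3, cj_apply, _root_.map_mul, map_pow]
  have hPpos := norm_pos' h1
  obtain ⟨r1, r2⟩ := exists_conj_of_align (hP.zpow ε) ((hP.zpow δ).act d)
    (fun h => h1 (zpow_left_injective hε0 (by simpa using h)))
    (by rw [act_norm, hεn, hδn]) hp' (hpδ.act d) (N := N)
    (by rw [hεn]; nlinarith) e1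
  obtain ⟨g, hg⟩ := conj_of_isRotated r1
  obtain ⟨rfl, -, hdP⟩ := cj_zpow_eq hrc hP h1 hδ0 hε0 (z := ⟨g, d⟩) (by rw [cj_apply, hg])
  have hdY : act B X d Y = Y := hx.generic d hdP y Y hy
  rw [map_zpow, map_zpow, hdP, hdY] at r2
  rw [map_zpow, map_zpow, hdP, hdY] at e1
  obtain ⟨q, hq, hY'⟩ := r2 rfl
  have hq' : Commute q P := commute_of_commute_zpow hδ0 hq
  set U := (P ^ δ) ^ N * Y ^ δ with hUdef
  have e4 : q * U * q⁻¹ = f * U * f⁻¹ := by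
    rw [← e1, hY', hUdef]
    have := (hq.pow_right N).eq
    calc _ = (q * (P ^ δ) ^ N) * Y ^ δ * q⁻¹ := by group
      _ = _ := by rw [this]; group
  obtain ⟨j, hj⟩ := hroot (q⁻¹ * f) (by
    rw [Commute, SemiconjBy]
    calc q⁻¹ * f * U = q⁻¹ * (f * U * f⁻¹) * f := by group
      _ = _ := by rw [← e4]; group)
  have hdU : act B X d U = U := by simp [hUdef, hdP, hdY]
  set w := z' * ((x ^ δ) ^ N * y ^ δ) ^ (-j) with hw
  have hwl : (ι w).left = q := by
    rw [hw, _root_.map_mul, map_zpow, hU, ← map_zpow, mul_left, ← hf, ← hd, left_inl, map_zpow, hdU,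
      zpow_neg, ← hj]
    group
  have hwr : (ι w).right = d := by
    rw [hw, _root_.map_mul, map_zpow, hU, ← map_zpow, mul_right, right_inl, mul_one]
  refine ⟨w, ?_, ?_⟩
  · rw [← commute_map_iff hι, hx.map_eq, ← cj_eq_self_iff, cj_apply, hwl, hwr, hdP, hq'.eq]
    group
  · apply hι
    rw [hy', _root_.map_mul, _root_.map_mul, _root_.map_inv, map_zpow, hy, ← map_zpow, ← inl_cj,
      cj_apply, hwl, hwr, map_zpow, hdY, hY']

theorem Base.exists_conj_of_map_eq (hB : Nice B) (hrc : RootClosed B X)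
    (hι : Function.Injective ι) {φ : H →* H} (hφ : ∀ h, CommElem (φ h) h) {x y : H}
    {P Q : FreeGroup X} (hx : Base ι x P) (hy : ι y = inl Q) (hPQ : ¬ Commute P Q)
    {ε : ℤ} (hε : ε = 1 ∨ ε = -1) (hφx : φ x = x ^ ε) :
    ∃ w, Commute w x ∧ φ y = w * y ^ ε * w⁻¹ := by
  have := hB.torsionFree
  obtain ⟨Q', hQ'⟩ := map_commElem_left (ι := ι) hφ hy
  have hε0 : ε ≠ 0 := by rcases hε with rfl | rfl <;> norm_num
  set M := 2 * (Q.norm + Q'.norm) + 2 with hM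
  have h1 := hx.ne_one
  obtain ⟨w, hw, h⟩ := hx.exists_conj_of_padded hB hrc hι hφ (y := x ^ M * y * x ^ M)
    (Y := P ^ M * Q * P ^ M) (Y' := (P ^ ε) ^ M * Q' * (P ^ ε) ^ M) (by simp [hx.map_eq, hy])
    (fun h => hPQ (commute_conj_pow h)) (eventually_padded hx.cr h1 Q M (by omega)) hε hφx
    (by simp [hφx, hx.map_eq, hQ'])
    (eventually_padded (hx.cr.zpow ε) (fun h => h1 (zpow_left_injective hε0 (by simpa using h)))
      Q' M (by omega))
  refine ⟨w, hw, ?_⟩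
  rw [_root_.map_mul, _root_.map_mul, map_pow, hφx] at h
  have hc : (x ^ ε) ^ M * w = w * (x ^ ε) ^ M := ((hw.zpow_right ε).pow_right M).symm.eq
  have hc' : w⁻¹ * (x ^ ε) ^ M = (x ^ ε) ^ M * w⁻¹ := ((hw.zpow_right ε).pow_right M).inv_left.eq
  have e : (x ^ M * y * x ^ M) ^ ε = (x ^ ε) ^ M * y ^ ε * (x ^ ε) ^ M := by
    rcases hε with rfl | rfl
    · simp
    · simp [mul_assoc]
  rw [e] at h
  apply mul_left_cancel (a := (x ^ ε) ^ M)
  apply mul_right_cancel (b := (x ^ ε) ^ M)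
  rw [h]
  calc _ = (w * (x ^ ε) ^ M) * y ^ ε * ((x ^ ε) ^ M * w⁻¹) := by group
    _ = _ := by rw [← hc, ← hc']; group

theorem Base.exists_conj (hB : Nice B) (hrc : RootClosed B X)
    (hι : Function.Injective ι) {φ : H →* H} (hφ : ∀ h, CommElem (φ h) h) {x y : H}
    {P Q : FreeGroup X} (hx : Base ι x P) (hy : ι y = inl Q) (hxy : ¬ Commute x y) :
    ∃ c, φ x = c * x * c⁻¹ ∧ φ y = c * y * c⁻¹ := by
  have hH : Nice H := (hB.semidirect hrc).of_injective ι hι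
  have := hH.torsionFree
  have tr : ∀ {k : H} {R : FreeGroup X}, ι k = inl R → (Commute x k ↔ Commute P R) := by
    intro k R hk
    rw [← commute_map_iff hι, hx.map_eq, hk, commute_map_iff inl_injective]
  obtain ⟨z, ε, hε, hz⟩ := exists_conj_sign hB hrc hι hφ hx.map_eq hy hx.cr hx.ne_one
    (fun h => hxy ((tr hy).mpr h))
  have hψ := commElem_conjEnd hφ z⁻¹
  set ψ := conjEnd z⁻¹ φ with hψdef
  have hψx : ψ x = x ^ ε := by rw [hψdef, conjEnd_apply, hz]; group
  obtain ⟨w, hw, hψy⟩ := hx.exists_conj_of_map_eq hB hrc hι hψ hy (fun h => hxy ((tr hy).mpr h))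
    hε hψx
  rcases hε with rfl | rfl
  · refine ⟨z * w, ?_, ?_⟩
    · rw [hz, mul_assoc z w, mul_assoc, mul_assoc, mul_inv_rev, ← mul_assoc (w * x), hw.eq]
      group
    · rw [hψdef, conjEnd_apply] at hψy
      rw [show φ y = z * (z⁻¹ * φ y * z⁻¹⁻¹) * z⁻¹ by group, hψy]
      group
  · exfalso
    have hc : ι (x * y * x⁻¹ * y⁻¹) = inl (P * Q * P⁻¹ * Q⁻¹) := by simp [hx.map_eq, hy]
    have hnc : ¬ Commute x (x * y * x⁻¹ * y⁻¹) := by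
      intro h
      have h2 : Commute x (y * x * y⁻¹) := by
        have h3 := ((Commute.refl x).inv_right.mul_right h).inv_right
        convert h3 using 1
        group
      have := hH.conj_commute x y h2
      exact hxy (mul_inv_eq_iff_eq_mul.mp this).symm
    obtain ⟨w', -, h'⟩ := hx.exists_conj_of_map_eq hB hrc hι hψ hc (fun h => hnc ((tr hc).mpr h))
      (Or.inr rfl) hψx
    have h2 : ψ (x * y * x⁻¹ * y⁻¹) = w * (y * x)⁻¹ * (x * y * x⁻¹ * y⁻¹) * (w * (y * x)⁻¹)⁻¹ := by
      simp only [_root_.map_mul, _root_.map_inv, hψx, hψy, zpow_neg, zpow_one, inv_inv, mul_inv_rev]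
      have e : x⁻¹ * w = w * x⁻¹ := hw.symm.inv_left.eq
      have e' : w⁻¹ * x = x * w⁻¹ := hw.inv_left.eq
      calc _ = (x⁻¹ * w) * y⁻¹ * (w⁻¹ * x) * w * y * w⁻¹ := by group
        _ = _ := by rw [e, e']; group
    have h3 : x * y * x⁻¹ * y⁻¹ ≠ 1 := by
      intro h
      rw [h] at hnc
      exact hnc (Commute.one_right x)
    rw [h2] at h'
    have := hH.zpow_conj _ ((w * (y * x)⁻¹)⁻¹ * w') (-1) 1 h3 (by norm_num) (by norm_num) (by
      rw [zpow_one]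
      calc x * y * x⁻¹ * y⁻¹ = (w * (y * x)⁻¹)⁻¹ * (w * (y * x)⁻¹ * (x * y * x⁻¹ * y⁻¹) *
          (w * (y * x)⁻¹)⁻¹) * (w * (y * x)⁻¹) := by group
        _ = _ := by rw [h']; group)
    norm_num at this

end

theorem per_sub {α : Type*} {w : List α} {a c : ℕ} (hac : c ≤ a) (hw : w ≠ [])
    (h : ∀ i < w.length, per w (i + a) = per w (i + c)) (i : ℕ) :
    per w (i + (a - c)) = per w i := by
  have h0 : 0 < w.length := List.length_pos_iff.mpr hw
  have add_mul : ∀ i m, per w (i + m * w.length) = per w i := by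
    intro i m
    rw [← per_mod, Nat.add_mul_mod_self_right, per_mod]
  have hall : ∀ i, per w (i + a) = per w (i + c) := by
    intro i
    have h2 := h _ (Nat.mod_lt i h0)
    have e : i = i % w.length + i / w.length * w.length := by
      rw [mul_comm]; exact (Nat.mod_add_div i w.length).symm
    have h3 := add_mul (i % w.length + a) (i / w.length)
    have h4 := add_mul (i % w.length + c) (i / w.length)
    rw [add_right_comm, ← e] at h3 h4
    rw [h3, h2, h4]
  have hc : c ≤ c * w.length := Nat.le_mul_of_pos_right _ h0
  have h2 := hall (i + (c * w.length - c))
  rw [show i + (c * w.length - c) + a = i + (a - c) + c * w.length by omega,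
    show i + (c * w.length - c) + c = i + c * w.length by omega, add_mul, add_mul] at h2
  exact h2

section
variable {X : Type*}

theorem commute_mk_of_per {A D w : List (X × Bool)} (hw : w ≠ []) (hDA : D.length ≤ A.length)
    (hA : ∀ i < A.length, A[i]? = per w i) (hD : ∀ i < D.length, D[i]? = per w i)
    (h : ∀ i < w.length, per w (i + A.length) = per w (i + D.length)) :
    Commute (mk A * (mk D)⁻¹) (mk w) := by
  have hs := per_sub hDA hw h
  have hdrop : A.drop (A.length - D.length) = D := by
    apply List.ext_getElem?
    intro i
    rw [List.getElem?_drop]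
    by_cases hi : i < D.length
    · rw [hA _ (by omega), hD _ hi, add_comm, hs]
    · rw [List.getElem?_eq_none (by omega), List.getElem?_eq_none (by omega)]
  have hA' : mk A = mk (A.take (A.length - D.length)) * mk D := by
    rw [← mk_append]
    conv_rhs => rhs; rhs; rw [← hdrop]
    rw [List.take_append_drop]
  rw [hA', mul_inv_cancel_right, Commute, SemiconjBy, ← mk_append, ← mk_append]
  have hl : (A.take (A.length - D.length)).length = A.length - D.length := by simp
  congr 1
  apply append_comm_of_periods (f := per w)
  · intro i hi
    rw [hl] at hi
    rw [List.getElem?_take_of_lt hi, hA _ (by omega)]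
  · exact fun i hi => (per_of_lt hi).symm
  · intro i _
    rw [hl, hs]
  · exact fun i _ => per_add_length _ _

variable [DecidableEq X]

theorem commute_of_mul_eq_mul {P W k k' : FreeGroup X} (h1 : P ≠ 1) {N : ℕ}
    (hW : (replicate N P.toWord).flatten <+: W.toWord)
    (hN : P.norm + k.norm + k'.norm ≤ N * P.norm) (h : W * k = k' * W) : Commute k' P := by
  obtain ⟨A, C, B', hA, hB', hAB⟩ := toWord_mul_cancel k' W
  obtain ⟨A₂, C₂, B₂, hA₂, hB₂, hAB₂⟩ := toWord_mul_cancel W k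
  obtain ⟨R, hR⟩ := hW
  have e : A ++ B' = A₂ ++ B₂ := by rw [← hAB, ← hAB₂, h]
  have hWper : ∀ i < N * P.norm, W.toWord[i]? = per P.toWord i := by
    intro i hi
    rw [← hR, List.getElem?_append_left (by simpa [FreeGroup.norm] using hi),
      getElem?_flatten_replicate _ _ _ hi]
  have hWl : N * P.norm ≤ W.toWord.length := by
    rw [← hR]; simp [FreeGroup.norm]
  have hk : k.norm = C₂.length + B₂.length := by
    rw [FreeGroup.norm, hB₂, List.length_append, invRev_length]
  have hk' : k'.norm = A.length + C.length := by rw [FreeGroup.norm, hA, List.length_append]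
  have hA₂l : W.toWord.length = A₂.length + C₂.length := by rw [hA₂, List.length_append]
  have hA₂per : ∀ i < N * P.norm - k.norm, (A ++ B')[i]? = per P.toWord i := by
    intro i hi
    rw [e, List.getElem?_append_left (by omega), ← hWper i (by omega), hA₂,
      List.getElem?_append_left (by omega)]
  have hBper : ∀ i, B'[i]? = W.toWord[i + C.length]? := by
    intro i
    rw [hB', List.getElem?_append_right (by simp), invRev_length, Nat.add_sub_cancel]
  have hAper : ∀ i < A.length, A[i]? = per P.toWord i := by
    intro i hi
    rw [← hA₂per i (by omega), List.getElem?_append_left hi]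
  have hCper : ∀ i < (invRev C).length, (invRev C)[i]? = per P.toWord i := by
    intro i hi
    have hi' := hi
    rw [invRev_length] at hi'
    rw [← hWper i (by omega), hB', List.getElem?_append_left hi]
  have hshift : ∀ i < P.toWord.length, per P.toWord (i + A.length) =
      per P.toWord (i + (invRev C).length) := by
    intro i hi
    change i < P.norm at hi
    rw [← hA₂per _ (by omega), List.getElem?_append_right (by omega), Nat.add_sub_cancel, hBper,
      hWper _ (by omega), invRev_length]
  have hkk : k' = mk A * (mk (invRev C))⁻¹ := by
    rw [← mk_toWord (x := k'), hA, mk_append, inv_mk, invRev_invRev]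
  have hP := toWord_ne_nil h1
  rcases le_total (invRev C).length A.length with hle | hle
  · have := commute_mk_of_per hP hle hAper hCper hshift
    rwa [mk_toWord, ← hkk] at this
  · have := (commute_mk_of_per hP hle hCper hAper (fun i hi => (hshift i hi).symm)).inv_left
    rw [mul_inv_rev, inv_inv, mk_toWord, ← hkk] at this
    exact this

end

section
variable {B X H : Type*} [Group B] [MulAction B X] [Group H] {ι : H →* SD B X} [DecidableEq X]

open SemidirectProduct

theorem Padded.prefix_pow {P Y : FreeGroup X} (h : Padded P Y) (hP : CR P) (h1 : P ≠ 1) {N : ℕ}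
    (hN : N ≠ 0) {j : ℕ} (hj : j ≠ 0) :
    (replicate N P.toWord).flatten <+: ((P ^ N * Y) ^ j).toWord := by
  obtain ⟨j, rfl⟩ := Nat.exists_eq_succ_of_ne_zero hj
  rw [(h.CR_mul hP h1 hN).toWord_pow, List.replicate_succ, List.flatten_cons,
    h.toWord_mul hP h1 hN, List.append_assoc]
  exact List.prefix_append _ _

theorem Base.exists_padded {x y : H} {P Q : FreeGroup X} (hx : Base ι x P) (hy : ι y = inl Q)
    (hPQ : ¬ Commute P Q) : ∃ y₀ Y, ι y₀ = inl Y ∧ Padded P Y ∧ ¬ Commute P Y :=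
  ⟨x ^ (2 * Q.norm + 2) * y * x ^ (2 * Q.norm + 2), P ^ (2 * Q.norm + 2) * Q * P ^ (2 * Q.norm + 2),
    by simp [hx.map_eq, hy], eventually_padded hx.cr hx.ne_one Q _ le_rfl,
    fun h => hPQ (commute_conj_pow h)⟩

omit [DecidableEq X] in
theorem commute_iff_of_map_eq (hι : Function.Injective ι) {x k : H} {P R : FreeGroup X}
    (hx : ι x = inl P) (hk : ι k = inl R) : Commute x k ↔ Commute P R := by
  rw [← commute_map_iff hι, hx, hk, commute_map_iff inl_injective]

theorem Base.exists_special (hrc : RootClosed B X) (hι : Function.Injective ι) {x y : H}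
    {P Q : FreeGroup X} (hx : Base ι x P) (hy : ι y = inl Q) (hPQ : ¬ Commute P Q) :
    ∃ k₀ Y₀, ι k₀ = inl Y₀ ∧ k₀ ≠ 1 ∧
      ∀ z, Commute z k₀ → ∃ i : ℤ, ∀ k Y, ι k = inl Y → Commute (k₀ ^ i * z) k := by
  obtain ⟨y₀, Y, hy₀, hp, hPY⟩ := hx.exists_padded hy hPQ
  obtain ⟨N, hN⟩ := exists_zpow_of_commute hx.cr hx.ne_one hPY
  have hu := hx.mul hy₀ hp (N := N + 1) (by omega)
  refine ⟨_, _, hu.map_eq, ?_, ?_⟩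
  · rintro h
    have := hu.map_eq
    rw [h, _root_.map_one, eq_comm, ← _root_.map_one inl, inl_injective.eq_iff] at this
    exact hu.ne_one this
  · intro z hz
    obtain ⟨h1, h2⟩ := hu.of_commute hrc hz
    obtain ⟨j, hj⟩ := hN (N + 1) (by omega) _ h1
    refine ⟨-j, fun k Y hk => ?_⟩
    rw [← commute_map_iff hι, hk, ← cj_eq_self_iff, _root_.map_mul, cj_mul, cj_apply (ι z),
      h2 k Y hk, map_zpow, hu.map_eq, ← map_zpow, cj_inl, hj]
    group

theorem Base.exists_conj_forall (hB : Nice B) (hrc : RootClosed B X)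
    (hι : Function.Injective ι) {φ : H →* H} (hφ : ∀ h, CommElem (φ h) h) {x y : H}
    {P Q : FreeGroup X} (hx : Base ι x P) (hy : ι y = inl Q) (hPQ : ¬ Commute P Q) :
    ∃ w, ∀ k Y, ι k = inl Y → φ k = w * k * w⁻¹ := by
  have := hB.torsionFree
  have := ((hB.semidirect hrc).of_injective ι hι).torsionFree
  obtain ⟨y₀, Y₀, hy₀, hp, hPY⟩ := hx.exists_padded hy hPQ
  obtain ⟨N₀, hN₀⟩ := exists_zpow_of_commute hx.cr hx.ne_one hPY
  have hxy : ¬ Commute x y₀ := fun h => hPY ((commute_iff_of_map_eq hι hx.map_eq hy₀).mp h)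
  obtain ⟨c, hcx, hcy⟩ := hx.exists_conj hB hrc hι hφ hy₀ hxy
  have hψ := commElem_conjEnd hφ c⁻¹
  set ψ := conjEnd c⁻¹ φ with hψdef
  have hψx : ψ x = x := by rw [hψdef, conjEnd_apply, hcx]; group
  have hψy : ψ y₀ = y₀ := by rw [hψdef, conjEnd_apply, hcy]; group
  have hinj := injective_of_commElem hψ
  have key : ∀ k Y, ι k = inl Y → ¬ Commute x k → ψ k = k := by
    intro k Y hk hxk
    obtain ⟨Y', hk'⟩ := map_commElem_left (ι := ι) hψ hk
    set N := N₀ + 1 + Y.norm + Y'.norm with hN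
    have hN0 : N ≠ 0 := by omega
    have hu := hx.mul hy₀ hp hN0
    have hψu : ψ (x ^ N * y₀) = x ^ N * y₀ := by rw [_root_.map_mul, map_pow, hψx, hψy]
    have hroot := hN₀ N (by omega)
    by_cases hc : Commute (x ^ N * y₀) k
    · obtain ⟨j, hj⟩ := hroot Y ((commute_iff_of_map_eq hι hu.map_eq hk).mp hc).symm
      have : k = (x ^ N * y₀) ^ j := hι (by rw [hk, hj, map_zpow, map_zpow, hu.map_eq])
      rw [this, map_zpow, hψu]
    obtain ⟨d, hdu, hdk⟩ := hu.exists_conj hB hrc hι hψ hk hc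
    rw [hψu] at hdu
    obtain ⟨h1, h2⟩ := hu.of_commute hrc (z := d) (eq_mul_inv_iff_mul_eq.mp hdu).symm
    obtain ⟨j, hj⟩ := hroot _ h1
    have hY' : Y' = (P ^ N * Y₀) ^ j * Y * ((P ^ N * Y₀) ^ j)⁻¹ := by
      apply inl_injective (φ := act B X)
      rw [← hk', hdk, _root_.map_mul, _root_.map_mul, _root_.map_inv, hk, ← inl_cj, cj_apply,
        h2 k Y hk, hj]
    have hPpos := norm_pos' hx.ne_one
    have hbound : P.norm + Y.norm + Y'.norm ≤ N * P.norm := by nlinarith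
    obtain ⟨j, rfl | rfl⟩ := j.eq_nat_or_neg
    · rcases eq_or_ne j 0 with rfl | hj0
      · apply hι
        rw [hk', hk, hY']; simp
      exfalso
      rw [zpow_natCast] at hY'
      have := commute_of_mul_eq_mul hx.ne_one (hp.prefix_pow hx.cr hx.ne_one hN0 hj0) hbound
        (by rw [hY']; group)
      rw [← commute_iff_of_map_eq hι hk' hx.map_eq] at this
      nth_rewrite 1 [← hψx] at this
      exact hxk ((commute_map_iff hinj).mp this).symm
    · rcases eq_or_ne j 0 with rfl | hj0
      · apply hι
        rw [hk', hk, hY']; simp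
      exfalso
      rw [zpow_neg, zpow_natCast] at hY'
      have := commute_of_mul_eq_mul hx.ne_one (hp.prefix_pow hx.cr hx.ne_one hN0 hj0)
        (k := Y') (k' := Y) (by omega) (by rw [hY']; group)
      rw [← commute_iff_of_map_eq hι hk hx.map_eq] at this
      exact hxk this.symm
  have key2 : ∀ k Y, ι k = inl Y → ψ k = k := by
    intro k Y hk
    by_cases hxk : Commute x k
    · have h1 := key (k * y₀) (Y * Y₀) (by simp [hk, hy₀]) (fun h => hxy (by
        simpa using hxk.inv_right.mul_right h))
      rw [_root_.map_mul, hψy] at h1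
      exact mul_right_cancel h1
    · exact key k Y hk hxk
  refine ⟨c, fun k Y hk => ?_⟩
  have h := key2 k Y hk
  rw [hψdef, conjEnd_apply] at h
  conv_rhs => rw [← h]
  group

/-- Pointwise stabilizers of subsets of `X` are pointwise stabilizers of finite subsets. -/
def FinitelyFixed (B X : Type*) [Group B] [MulAction B X] : Prop :=
  ∀ S : Set X, ∃ T ⊆ S, T.Finite ∧ ∀ b : B, (∀ x ∈ T, b • x = x) → ∀ x ∈ S, b • x = x

theorem exists_cr_supp {x₁ : H} {P₁ : FreeGroup X} (hx : ι x₁ = inl P₁) (hP : CR P₁)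
    (h1 : P₁ ≠ 1) {T : Set X} (hT : T.Finite)
    (h : ∀ s ∈ T, ∃ k Y, ι k = inl Y ∧ s ∈ supp Y) :
    ∃ x P, ι x = inl P ∧ CR P ∧ P ≠ 1 ∧ T ⊆ supp P := by
  induction T, hT using Set.Finite.induction_on with
  | empty => exact ⟨x₁, P₁, hx, hP, h1, Set.empty_subset _⟩
  | @insert s T _ _ ih =>
    obtain ⟨x, P, hx, hP, h1, hTP⟩ := ih fun t ht => h t (Set.mem_insert_of_mem _ ht)
    obtain ⟨k, Y, hk, hs⟩ := h s (Set.mem_insert _ _)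
    set M := 2 * Y.norm + 2
    have hp := eventually_padded hP h1 Y M le_rfl
    have hw := hp.toWord_mul hP h1 one_ne_zero
    have hsupp : supp (P ^ 1 * (P ^ M * Y * P ^ M)) = supp P ∪ supp (P ^ M * Y * P ^ M) := by
      ext a
      simp only [supp, hw, Set.mem_ofPred_eq, Set.mem_union, List.mem_append, exists_or]
      simp
    refine ⟨x ^ 1 * (x ^ M * k * x ^ M), _, by simp [hx, hk], hp.CR_mul hP h1 one_ne_zero, ?_, ?_⟩
    · intro h2
      rw [h2] at hw
      simp at hw
      exact hp.ne_one h1 hw.2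
    · rw [hsupp, Set.insert_subset_iff]
      refine ⟨?_, hTP.trans Set.subset_union_left⟩
      have hY : Y = (P ^ M)⁻¹ * (P ^ M * Y * P ^ M) * (P ^ M)⁻¹ := by group
      rw [hY] at hs
      have hPM : supp (P ^ M)⁻¹ ⊆ supp P := by rw [supp_inv]; exact supp_pow _ _
      rcases supp_mul _ _ hs with hs | hs
      · rcases supp_mul _ _ hs with hs | hs
        · exact Or.inl (hPM hs)
        · exact Or.inr hs
      · exact Or.inl (hPM hs)

theorem exists_base (hff : FinitelyFixed B X) {a : H} {Q : FreeGroup X} (ha : ι a = inl Q)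
    (h1 : Q ≠ 1) : ∃ (f : FreeGroup X) (x : H) (P : FreeGroup X),
      Base ((MulAut.conj (inl f)).toMonoidHom.comp ι) x P := by
  obtain ⟨g, c, hc, rfl⟩ := exists_conj_CR Q
  set ι' := (MulAut.conj (inl g⁻¹ : SD B X)).toMonoidHom.comp ι with hι'
  have ha' : ι' a = inl c := by
    have : ι' a = inl g⁻¹ * ι a * (inl g⁻¹)⁻¹ := rfl
    rw [this, ha, ← inl_cj, cj_inl]
    congr 1
    group
  have hc1 : c ≠ 1 := by rintro rfl; simp at h1
  obtain ⟨T, hTS, hT, hfix⟩ := hff {s | ∃ k Y, ι' k = inl Y ∧ s ∈ supp Y}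
  obtain ⟨x, P, hx, hP, hP1, hTP⟩ := exists_cr_supp ha' hc hc1 hT hTS
  refine ⟨g⁻¹, x, P, hx, hP, hP1, fun b hb k Y hk => ?_⟩
  rw [act_eq_self_iff] at *
  intro s hs
  exact hfix b (fun t ht => hb t (hTP ht)) s ⟨k, Y, hk, hs⟩

/-- The part of `H` lying in the free factor, if non-abelian, is mapped by a commensurating
endomorphism as by a conjugation, and it has an element with the smallest possible centralizer. -/
theorem exists_conj_on_left (hB : Nice B) (hrc : RootClosed B X) (hff : FinitelyFixed B X)
    (hι : Function.Injective ι) {φ : H →* H} (hφ : ∀ h, CommElem (φ h) h) {a b : H}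
    (ha : (ι a).right = 1) (hb : (ι b).right = 1) (hab : ¬ Commute a b) :
    (∃ w, ∀ k, (ι k).right = 1 → φ k = w * k * w⁻¹) ∧
    ∃ k₀, (ι k₀).right = 1 ∧ k₀ ≠ 1 ∧
      ∀ z, Commute z k₀ → ∃ i : ℤ, ∀ k, (ι k).right = 1 → Commute (k₀ ^ i * z) k := by
  have h1 : (ι a).left ≠ 1 := by
    intro h
    apply hab
    rw [← commute_map_iff hι, eq_inl_of_right ha, h, _root_.map_one]
    exact Commute.one_left _
  obtain ⟨f, x, P, hx⟩ := exists_base hff (eq_inl_of_right ha) h1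
  set ι' := (MulAut.conj (inl f : SD B X)).toMonoidHom.comp ι with hι'def
  have happ : ∀ h, ι' h = inl f * ι h * (inl f)⁻¹ := fun h => rfl
  have hι' : Function.Injective ι' := (MulAut.conj _).injective.comp hι
  have hr : ∀ h, (ι' h).right = (ι h).right := by
    intro h; rw [happ]; simp
  have hK : ∀ k, (ι k).right = 1 ↔ ∃ Y, ι' k = inl Y := by
    intro k
    rw [← hr]
    exact ⟨fun h => ⟨_, eq_inl_of_right h⟩, fun ⟨Y, hY⟩ => by rw [hY, right_inl]⟩
  obtain ⟨Qa, hQa⟩ := (hK a).mp ha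
  obtain ⟨Qb, hQb⟩ := (hK b).mp hb
  obtain ⟨y, Q, hy, hPQ⟩ : ∃ y Q, ι' y = inl Q ∧ ¬ Commute P Q := by
    by_contra! hcon
    have h2 := hcon a Qa hQa
    have h3 := hcon b Qb hQb
    exact hab ((commute_iff_of_map_eq hι' hQa hQb).mpr
      (freeGroup_commute_trans hx.ne_one h2.symm h3))
  constructor
  · obtain ⟨w, hw⟩ := hx.exists_conj_forall hB hrc hι' hφ hy hPQ
    exact ⟨w, fun k hk => ((hK k).mp hk).elim fun Y hY => hw k Y hY⟩
  · obtain ⟨k₀, Y₀, h2, h3, h4⟩ := hx.exists_special hrc hι' hy hPQ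
    refine ⟨k₀, (hK k₀).mpr ⟨_, h2⟩, h3, fun z hz => ?_⟩
    obtain ⟨i, hi⟩ := h4 z hz
    exact ⟨i, fun k hk => ((hK k).mp hk).elim fun Y hY => hi k Y hY⟩

end

/-- `H` is abelian or all of its commensurating endomorphisms are inner. -/
def InnerRigid (H : Type*) [Group H] : Prop :=
  (∀ a b : H, Commute a b) ∨
    ∀ φ : H →* H, (∀ h, CommElem (φ h) h) → ∃ w, ∀ h, φ h = w * h * w⁻¹

theorem Nice.eq_self_of_forall_commute {H : Type*} [Group H] (hH : Nice H) {a b : H}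
    (hab : ¬ Commute a b) {φ : H →* H} (hφ : ∀ h, CommElem (φ h) h)
    (hc : ∀ h k, Commute (h⁻¹ * φ h) k) (h : H) : φ h = h := by
  have := hH.torsionFree
  have key : ∀ h k, ¬ Commute k h → φ h = h := by
    intro h k hk
    obtain ⟨κ, hκ⟩ : ∃ κ, κ = h⁻¹ * φ h := ⟨_, rfl⟩
    have hκc : ∀ k, Commute κ k := hκ ▸ hc h
    have hφh : φ h = h * κ := by rw [hκ]; group
    obtain ⟨z, m, n, hm, hn, hz⟩ := hφ h
    have hz' : h ^ n * κ ^ n = z * h ^ m * z⁻¹ := by rw [← hz, hφh, (hκc h).symm.mul_zpow]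
    have hnm : n = m := by
      by_contra hne
      have hu : (h ^ (n - m) * κ ^ n) ^ n = z * (h ^ (n - m) * κ ^ n) ^ m * z⁻¹ := by
        have c1 : Commute (h ^ (n - m)) (κ ^ n) := ((hκc h).symm.zpow_left _).zpow_right _
        have c2 : Commute (h ^ n) (κ ^ n) := ((hκc h).symm.zpow_left _).zpow_right _
        have e1 : (h ^ (n - m) * κ ^ n) ^ n = (h ^ n * κ ^ n) ^ (n - m) * κ ^ (n * m) := by
          rw [c1.mul_zpow, c2.mul_zpow, ← zpow_mul, ← zpow_mul, ← zpow_mul, ← zpow_mul, mul_assoc,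
            ← zpow_add]
          congr 2 <;> ring
        have c3 : Commute (κ ^ (n * m)) z⁻¹ := (hκc z⁻¹).zpow_left _
        rw [e1, hz', conj_zpow, ← zpow_mul, c1.mul_zpow, ← zpow_mul, ← zpow_mul, mul_assoc,
          ← c3.eq, mul_comm m]
        group
      by_cases h1 : h ^ (n - m) * κ ^ n = 1
      · have h2 : h ^ (n - m) = (κ ^ n)⁻¹ := eq_inv_of_mul_eq_one_left h1
        have h3 : Commute k (h ^ (n - m)) := by
          rw [h2]
          exact ((hκc k).symm.zpow_right n).inv_right
        exact hk (commute_of_commute_zpow (sub_ne_zero.mpr hne) h3)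
      · exact hne (hH.zpow_conj _ z m n h1 hm hn hu)
    subst hnm
    rw [← conj_zpow] at hz
    have h2 : φ h = z * h * z⁻¹ := zpow_left_injective hn hz
    rw [h2]
    apply hH.conj_commute
    rw [← h2, hφh]
    exact (Commute.refl h).mul_right (hκc h).symm
  by_cases hh : ∀ k, Commute k h
  · have h1 := key a b (fun h => hab h.symm)
    have h2 := key (h * a) b (fun h3 => hab (by
      have := (hh b).inv_right.mul_right h3
      simpa using this.symm))
    rw [_root_.map_mul, h1] at h2
    exact mul_right_cancel h2
  · push Not at hh
    obtain ⟨k, hk⟩ := hh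
    exact key h k hk

section
variable {B X H : Type*} [Group B] [MulAction B X] [Group H] {ι : H →* SD B X}

open SemidirectProduct

theorem eq_one_of_commute (hι : Function.Injective ι) {a b z : H}
    (ha : (ι a).right = 1) (hb : (ι b).right = 1) (hab : ¬ Commute a b) (hz : (ι z).right = 1)
    (hza : Commute z a) (hzb : Commute z b) : z = 1 := by
  by_contra h
  rw [commute_iff_of_map_eq hι (eq_inl_of_right ha) (eq_inl_of_right hb)] at hab
  rw [commute_iff_of_map_eq hι (eq_inl_of_right hz) (eq_inl_of_right ha)] at hza
  rw [commute_iff_of_map_eq hι (eq_inl_of_right hz) (eq_inl_of_right hb)] at hzb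
  refine hab (freeGroup_commute_trans ?_ hza.symm hzb)
  intro h0
  apply h
  apply hι
  rw [eq_inl_of_right hz, h0, _root_.map_one, _root_.map_one]

variable [DecidableEq X]

theorem exists_conj_of_left_not_commute (hB : Nice B) (hrc : RootClosed B X)
    (hff : FinitelyFixed B X) (hι : Function.Injective ι)
    (hrigid : ∀ L : Subgroup H, (∀ l ∈ L, (ι l).right = 1 → l = 1) → InnerRigid L)
    {φ : H →* H} (hφ : ∀ h, CommElem (φ h) h) {a b : H} (ha : (ι a).right = 1)
    (hb : (ι b).right = 1) (hab : ¬ Commute a b) : ∃ w, ∀ h, φ h = w * h * w⁻¹ := by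
  have hH : Nice H := (hB.semidirect hrc).of_injective ι hι
  have := hH.torsionFree
  obtain ⟨⟨w, hw⟩, k₀, hk₀, hk₀1, hsp⟩ := exists_conj_on_left hB hrc hff hι hφ ha hb hab
  have hψ := commElem_conjEnd hφ w⁻¹
  set ψ := conjEnd w⁻¹ φ with hψdef
  have hψK : ∀ k, (ι k).right = 1 → ψ k = k := by
    intro k hk
    rw [hψdef, conjEnd_apply, hw k hk]; group
  have hKn : ∀ g k, (ι k).right = 1 → (ι (g * k * g⁻¹)).right = 1 := by
    intro g k hk; simp [hk]
  let L : Subgroup H := Subgroup.centralizer {k | (ι k).right = 1}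
  have hL : ∀ {l}, l ∈ L ↔ ∀ k, (ι k).right = 1 → Commute k l := by
    intro l
    rw [Subgroup.mem_centralizer_iff]
    rfl
  have hLn : ∀ g l, l ∈ L → g * l * g⁻¹ ∈ L := by
    intro g l hl
    rw [hL] at hl ⊢
    intro k hk
    have h1 := hl _ (hKn g⁻¹ k hk)
    rw [← Commute.conj_iff g] at h1
    simpa [mul_assoc] using h1
  have hKL : ∀ l ∈ L, (ι l).right = 1 → l = 1 := by
    intro l hl hl1
    exact eq_one_of_commute hι ha hb hab hl1 (hL.mp hl a ha).symm (hL.mp hl b hb).symm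
  have hψL : ∀ l ∈ L, ψ l ∈ L := by
    intro l hl
    rw [hL] at hl ⊢
    intro k hk
    have := (hl k hk).map ψ
    rwa [hψK k hk] at this
  have hconj : ∀ l ∈ L, ∃ ζ ∈ L, ψ l = ζ * l * ζ⁻¹ := by
    intro l hl
    obtain ⟨z, m, n, hm, hn, hz⟩ := hψ (k₀ * l)
    rw [_root_.map_mul, hψK k₀ hk₀, (hL.mp (hψL l hl) k₀ hk₀).mul_zpow,
      (hL.mp hl k₀ hk₀).mul_zpow] at hz
    have h1 : (z * k₀ ^ m * z⁻¹)⁻¹ * k₀ ^ n = (z * l ^ m * z⁻¹) * (ψ l ^ n)⁻¹ := by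
      rw [inv_mul_eq_iff_eq_mul, ← mul_assoc, eq_mul_inv_iff_mul_eq, hz]
      group
    have h2 := hKL _ (h1 ▸ L.mul_mem (hLn z _ (L.zpow_mem hl m))
      (L.inv_mem (L.zpow_mem (hψL l hl) n))) (by simp [right_zpow, hk₀])
    have h3 : k₀ ^ n = z * k₀ ^ m * z⁻¹ := (inv_mul_eq_one.mp h2).symm
    obtain rfl := hH.zpow_conj k₀ z m n hk₀1 hm hn h3
    rw [← conj_zpow] at h3
    have h4 : k₀ = z * k₀ * z⁻¹ := zpow_left_injective hn h3
    rw [h1, mul_inv_eq_one, ← conj_zpow] at h2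
    have h5 : z * l * z⁻¹ = ψ l := zpow_left_injective hn h2
    obtain ⟨i, hi⟩ := hsp z (eq_mul_inv_iff_mul_eq.mp h4).symm
    refine ⟨k₀ ^ i * z, hL.mpr fun k hk => (hi k hk).symm, ?_⟩
    have h6 := ((hL.mp (hψL l hl) k₀ hk₀).zpow_left i).eq
    calc ψ l = (ψ l * k₀ ^ i) * (k₀ ^ i)⁻¹ := by group
      _ = _ := by rw [← h6, ← h5]; group
  obtain ⟨c, hcL, hc⟩ : ∃ c ∈ L, ∀ l ∈ L, ψ l = c * l * c⁻¹ := by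
    rcases hrigid L hKL with hab | hin
    · refine ⟨1, L.one_mem, fun l hl => ?_⟩
      obtain ⟨ζ, hζ, h⟩ := hconj l hl
      have h2 : ζ * l = l * ζ := congrArg Subtype.val (hab ⟨ζ, hζ⟩ ⟨l, hl⟩).eq
      rw [h, h2]; group
    · obtain ⟨c, hc⟩ := hin ((ψ.comp L.subtype).codRestrict L fun l => hψL l l.2) (by
        rintro ⟨l, hl⟩
        obtain ⟨ζ, hζ, h⟩ := hconj l hl
        exact ⟨⟨ζ, hζ⟩, 1, 1, one_ne_zero, one_ne_zero, by
          simp only [zpow_one]; exact Subtype.ext h⟩)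
      exact ⟨c, c.2, fun l hl => congrArg Subtype.val (hc ⟨l, hl⟩)⟩
  have hχ := commElem_conjEnd hψ c⁻¹
  set χ := conjEnd c⁻¹ ψ with hχdef
  have hχK : ∀ k, (ι k).right = 1 → χ k = k := by
    intro k hk
    rw [hχdef, conjEnd_apply, hψK k hk, inv_inv, mul_assoc, (hL.mp hcL k hk).eq]
    group
  have hχL : ∀ l ∈ L, χ l = l := by
    intro l hl
    rw [hχdef, conjEnd_apply, hc l hl]
    group
  have hfix : ∀ h k, χ k = k → χ (h * k * h⁻¹) = h * k * h⁻¹ → Commute (h⁻¹ * χ h) k := by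
    intro h k h1 h2
    rw [_root_.map_mul, _root_.map_mul, _root_.map_inv, h1] at h2
    rw [Commute, SemiconjBy]
    calc h⁻¹ * χ h * k = h⁻¹ * (χ h * k * (χ h)⁻¹) * χ h := by group
      _ = _ := by rw [h2]; group
  have hζL : ∀ h, h⁻¹ * χ h ∈ L := fun h => hL.mpr fun k hk =>
    (hfix h k (hχK k hk) (hχK _ (hKn h k hk))).symm
  have hid := hH.eq_self_of_forall_commute hab hχ fun h g => by
    have h1 : Commute (h⁻¹ * χ h) (g * (h⁻¹ * χ h) * g⁻¹) :=
      hfix h _ (hχL _ (hLn _ _ (hζL h))) (hχL _ (hLn _ _ (hLn _ _ (hζL h))))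
    have h2 := hH.conj_commute _ _ h1
    exact (mul_inv_eq_iff_eq_mul.mp h2).symm
  refine ⟨w * c, fun h => ?_⟩
  have h1 := hid h
  rw [hχdef, conjEnd_apply, hψdef, conjEnd_apply] at h1
  conv_rhs => rw [← h1]
  group

theorem innerRigid_of_left_commute (hB : Nice B) (hrc : RootClosed B X)
    (hι : Function.Injective ι) (hrigid : InnerRigid (H ⧸ (rightHom.comp ι).ker))
    (hK : ∀ a b, (ι a).right = 1 → (ι b).right = 1 → Commute a b) : InnerRigid H := by
  have hH : Nice H := (hB.semidirect hrc).of_injective ι hι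
  have := hB.torsionFree
  set K := (rightHom.comp ι).ker with hKdef
  have hmem : ∀ k, k ∈ K ↔ (ι k).right = 1 := fun k => Iff.rfl
  have hcent : ∀ k g, (ι k).right = 1 → Commute k g := by
    intro k g hk
    have h2 := hH.conj_commute k g (hK _ _ hk (by simp [hk]))
    exact (mul_inv_eq_iff_eq_mul.mp h2).symm
  by_cases hab : ∀ a b : H, Commute a b
  · exact Or.inl hab
  push Not at hab
  obtain ⟨a, b, hab⟩ := hab
  refine Or.inr fun φ hφ => ?_
  have hφK : K ≤ K.comap φ := by
    intro k hk
    obtain ⟨Y, hY⟩ := map_commElem_left (ι := ι) hφ (eq_inl_of_right ((hmem k).mp hk))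
    rw [Subgroup.mem_comap, hmem, hY, right_inl]
  rcases hrigid with h | h
  · exfalso
    apply hab
    have h1 : ((a : H ⧸ K)) * b = b * a := (h a b).eq
    rw [← QuotientGroup.mk_mul, ← QuotientGroup.mk_mul, QuotientGroup.eq, hmem] at h1
    have h2 := hH.conj_commute a b⁻¹ (by
      have h3 : b⁻¹ * a * b⁻¹⁻¹ = a * ((a * b)⁻¹ * (b * a))⁻¹ := by group
      rw [h3]
      exact (Commute.refl a).mul_right (hcent _ a h1).symm.inv_right)
    have h3 := mul_inv_eq_iff_eq_mul.mp h2
    exact (Commute.inv_right_iff.mp (show Commute a b⁻¹ from h3.symm))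
  · obtain ⟨w, hw⟩ := h (QuotientGroup.map K K φ hφK) (by
      intro q
      obtain ⟨h, rfl⟩ := QuotientGroup.mk_surjective q
      obtain ⟨z, m, n, hm, hn, hz⟩ := hφ h
      exact ⟨z, m, n, hm, hn, congrArg (QuotientGroup.mk (s := K)) hz⟩)
    obtain ⟨w, rfl⟩ := QuotientGroup.mk_surjective w
    have hid := hH.eq_self_of_forall_commute hab (commElem_conjEnd hφ w⁻¹) fun h k => by
      apply hcent
      have h1 : ((φ h : H) : H ⧸ K) = ((w * h * w⁻¹ : H) : H ⧸ K) := hw h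
      have h2 : ((h : H) : H ⧸ K) = ((w⁻¹ * φ h * w⁻¹⁻¹ : H) : H ⧸ K) := by
        rw [QuotientGroup.mk_mul, QuotientGroup.mk_mul, h1, ← QuotientGroup.mk_mul,
          ← QuotientGroup.mk_mul]
        congr 1
        group
      exact (hmem _).mp (QuotientGroup.eq.mp h2)
    refine ⟨w, fun h => ?_⟩
    have h1 := hid h
    rw [conjEnd_apply] at h1
    conv_rhs => rw [← h1]
    group

end

universe u

/-- The property propagated along semidirect products with free groups. -/
def Good (A : Type u) [Group A] : Prop :=
  Nice A ∧ ∀ (H : Type u) [Group H] (f : H →* A), Function.Injective f → InnerRigid H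

open SemidirectProduct in
theorem Good.semidirect {B X : Type u} [Group B] [MulAction B X] (hB : Good B)
    (hrc : RootClosed B X) (hff : FinitelyFixed B X) : Good (SD B X) := by
  classical
  refine ⟨hB.1.semidirect hrc, fun H _ ι hι => ?_⟩
  by_cases hK : ∀ a b, (ι a).right = 1 → (ι b).right = 1 → Commute a b
  · exact innerRigid_of_left_commute hB.1 hrc hι
      (hB.2 _ _ (QuotientGroup.kerLift_injective (rightHom.comp ι))) hK
  · push Not at hK
    obtain ⟨a, b, ha, hb, hab⟩ := hK
    refine Or.inr fun φ hφ => exists_conj_of_left_not_commute hB.1 hrc hff hι ?_ hφ ha hb hab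
    intro L hL
    refine hB.2 L ((rightHom.comp ι).comp L.subtype) ?_
    rw [injective_iff_map_eq_one]
    rintro ⟨l, hl⟩ h
    exact Subtype.ext (hL l hl h)

theorem Good.of_injective {A C : Type u} [Group A] [Group C] (hA : Good A) (f : C →* A)
    (hf : Function.Injective f) : Good C :=
  ⟨hA.1.of_injective f hf, fun H _ g hg => hA.2 H (f.comp g) (hf.comp hg)⟩

theorem good_of_subsingleton (A : Type u) [Group A] [Subsingleton A] : Good A := by
  refine ⟨⟨⟨fun n _ x y _ => Subsingleton.elim x y⟩,
    fun u _ _ _ h => (h (Subsingleton.elim u 1)).elim,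
    fun _ _ _ => Subsingleton.elim _ _⟩, fun H _ f hf => Or.inl fun a b => ?_⟩
  have := hf.subsingleton
  exact Subsingleton.elim _ _

section
variable {V : Type*} {Γ : SimpleGraph V}

theorem commute_of_adj {u v : V} (h : Γ.Adj u v) :
    Commute (PresentedGroup.of u : RAAG Γ) (PresentedGroup.of v) := by
  have h1 : (PresentedGroup.mk (raagRels Γ) (of u * of v * (of u)⁻¹ * (of v)⁻¹)) = 1 :=
    PresentedGroup.one_of_mem ⟨u, v, h, rfl⟩
  simp only [_root_.map_mul, _root_.map_inv] at h1
  rw [mul_inv_eq_one, mul_inv_eq_iff_eq_mul] at h1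
  exact h1

/-- The homomorphism out of `RAAG Γ` with given values on the vertices. -/
def raagLift {G : Type*} [Group G] (f : V → G) (hf : ∀ u v, Γ.Adj u v → Commute (f u) (f v)) :
    RAAG Γ →* G :=
  PresentedGroup.toGroup (f := f) (by
    rintro r ⟨u, v, h, rfl⟩
    simp only [_root_.map_mul, _root_.map_inv, FreeGroup.lift_apply_of]
    rw [mul_inv_eq_one, mul_inv_eq_iff_eq_mul]
    exact hf u v h)

theorem raagLift_of {G : Type*} [Group G] (f : V → G) (hf : ∀ u v, Γ.Adj u v → Commute (f u) (f v))
    (v : V) : raagLift f hf (PresentedGroup.of v) = f v :=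
  PresentedGroup.toGroup.of _

open Classical in
/-- The retraction of `RAAG Γ` killing the vertices outside `W`. -/
noncomputable def ret (W : Set V) : RAAG Γ →* RAAG Γ :=
  raagLift (fun v => if v ∈ W then PresentedGroup.of v else 1) (by
    intro u v h
    split_ifs
    · exact commute_of_adj h
    · exact Commute.one_right _
    · exact Commute.one_left _
    · exact Commute.one_left _)

theorem ret_of_mem {W : Set V} {v : V} (h : v ∈ W) :
    ret W (PresentedGroup.of v : RAAG Γ) = PresentedGroup.of v := by
  rw [ret, raagLift_of, if_pos h]

theorem ret_of_notMem {W : Set V} {v : V} (h : v ∉ W) :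
    ret W (PresentedGroup.of v : RAAG Γ) = 1 := by
  rw [ret, raagLift_of, if_neg h]

theorem ret_ret (W W' : Set V) (a : RAAG Γ) : ret W (ret W' a) = ret (W ∩ W') a := by
  have : (ret W).comp (ret W') = (ret (W ∩ W') : RAAG Γ →* RAAG Γ) := by
    ext v
    rw [MonoidHom.comp_apply]
    by_cases h' : v ∈ W'
    · rw [ret_of_mem h']
      by_cases h : v ∈ W
      · rw [ret_of_mem h, ret_of_mem (show v ∈ W ∩ W' from ⟨h, h'⟩)]
      · rw [ret_of_notMem h, ret_of_notMem fun h2 : v ∈ W ∩ W' => h h2.1]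
    · rw [ret_of_notMem h', _root_.map_one, ret_of_notMem fun h2 : v ∈ W ∩ W' => h' h2.2]
  exact DFunLike.congr_fun this a

variable (Γ) in
/-- The subgroup generated by the vertices in `W`. -/
noncomputable def parabolic (W : Set V) : Subgroup (RAAG Γ) := (ret W).eqLocus (MonoidHom.id _)

theorem mem_parabolic {W : Set V} {a : RAAG Γ} : a ∈ parabolic Γ W ↔ ret W a = a := Iff.rfl

theorem ret_mem (W : Set V) (a : RAAG Γ) : ret W a ∈ parabolic Γ W := by
  rw [mem_parabolic, ret_ret, Set.inter_self]

theorem ret_mem_inter {W M : Set V} {a : RAAG Γ} (ha : a ∈ parabolic Γ W) :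
    ret M a ∈ parabolic Γ (M ∩ W) := by
  rw [← mem_parabolic.mp ha, ret_ret]
  exact ret_mem _ _

theorem parabolic_mono {W W' : Set V} (h : W ⊆ W') : parabolic Γ W ≤ parabolic Γ W' := by
  intro a ha
  rw [mem_parabolic] at *
  rw [← ha, ret_ret, Set.inter_eq_right.mpr h]

theorem parabolic_univ : parabolic Γ Set.univ = ⊤ := by
  have : ret Set.univ = MonoidHom.id (RAAG Γ) := by
    ext v
    exact ret_of_mem (Set.mem_univ v)
  rw [parabolic, this, MonoidHom.eqLocus_same]

theorem eq_one_of_mem_parabolic_empty {a : RAAG Γ} (ha : a ∈ parabolic Γ ∅) : a = 1 := by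
  have : ret ∅ = (1 : RAAG Γ →* RAAG Γ) := by
    ext v
    exact ret_of_notMem (Set.notMem_empty v)
  rw [← mem_parabolic.mp ha, this, MonoidHom.one_apply]

theorem commute_of_mem_parabolic {W : Set V} {v : V} (h : W ⊆ Γ.neighborSet v) {a : RAAG Γ}
    (ha : a ∈ parabolic Γ W) : Commute (PresentedGroup.of v) a := by
  have : (MulAut.conj (PresentedGroup.of v)).toMonoidHom.comp (ret W) =
      (ret W : RAAG Γ →* RAAG Γ) := by
    ext u
    by_cases hu : u ∈ W
    · simp only [MonoidHom.comp_apply, ret_of_mem hu]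
      exact mul_inv_eq_iff_eq_mul.mpr (commute_of_adj (h hu)).eq
    · simp only [MonoidHom.comp_apply, ret_of_notMem hu, _root_.map_one]
  have h1 := DFunLike.congr_fun this a
  rw [MonoidHom.comp_apply, mem_parabolic.mp ha] at h1
  exact mul_inv_eq_iff_eq_mul.mp h1

theorem mem_parabolic_of_zpow {W M : Set V} (hW : IsMulTorsionFree (parabolic Γ W)) (hM : M ⊆ W)
    {c : RAAG Γ} (hc : c ∈ parabolic Γ W) {n : ℤ} (hn : n ≠ 0) (h : c ^ n ∈ parabolic Γ M) :
    c ∈ parabolic Γ M := by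
  rw [mem_parabolic, map_zpow] at h
  have h1 : (⟨ret M c, parabolic_mono hM (ret_mem M c)⟩ : parabolic Γ W) = ⟨c, hc⟩ :=
    zpow_left_injective hn (Subtype.ext h)
  exact congrArg Subtype.val h1

/-- The retraction onto a parabolic subgroup. -/
noncomputable def retP (W : Set V) : RAAG Γ →* parabolic Γ W := (ret W).codRestrict _ (ret_mem W)

theorem retP_of_mem {W : Set V} {a : RAAG Γ} (ha : a ∈ parabolic Γ W) : retP W a = ⟨a, ha⟩ :=
  Subtype.ext ha

theorem retP_of_notMem {W : Set V} {v : V} (h : v ∉ W) :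
    retP W (PresentedGroup.of v : RAAG Γ) = 1 :=
  Subtype.ext (ret_of_notMem h)

variable (Γ) in
/-- The cosets in the parabolic subgroup on `W` of the parabolic subgroup on the link of `v`. -/
abbrev Cosets (W : Set V) (v : V) :=
  parabolic Γ W ⧸ (parabolic Γ (W ∩ Γ.neighborSet v)).subgroupOf (parabolic Γ W)

theorem smul_mk_eq_iff {W : Set V} {v : V} (b g : parabolic Γ W) :
    b • (g : Cosets Γ W v) = g ↔
      (g : RAAG Γ)⁻¹ * b * g ∈ parabolic Γ (W ∩ Γ.neighborSet v) := by
  have h1 : b • (g : Cosets Γ W v) = ((b * g : parabolic Γ W) : Cosets Γ W v) := rfl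
  rw [h1, eq_comm, QuotientGroup.eq, Subgroup.mem_subgroupOf]
  simp [mul_assoc]

theorem rootClosed_cosets {W : Set V} (hW : IsMulTorsionFree (parabolic Γ W)) (v : V) :
    RootClosed (parabolic Γ W) (Cosets Γ W v) := by
  intro b n x hn hx
  obtain ⟨g, rfl⟩ := QuotientGroup.mk_surjective x
  rw [smul_mk_eq_iff] at *
  refine mem_parabolic_of_zpow hW Set.inter_subset_left (g⁻¹ * b * g).2 hn ?_
  convert hx using 1
  have := conj_zpow (a := (g : RAAG Γ)⁻¹) (b := b) (i := n)
  rw [inv_inv] at this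
  simpa using this

open SemidirectProduct

open Classical in
/-- The map splitting off the vertex `v`: the parabolic subgroup on `W ∪ {v}` is an extension of
the one on `W` by the free group spanned by the conjugates of `v`. -/
noncomputable def split (W : Set V) (v : V) : RAAG Γ →* SD (parabolic Γ W) (Cosets Γ W v) :=
  raagLift (fun u => if u = v then inl (of ((1 : parabolic Γ W) : Cosets Γ W v))
      else inr (retP W (PresentedGroup.of u))) (by
    have key : ∀ u, Γ.Adj v u → Commute
        (inl (of ((1 : parabolic Γ W) : Cosets Γ W v)) : SD (parabolic Γ W) (Cosets Γ W v))
        (inr (retP W (PresentedGroup.of u))) := by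
      intro u h
      have h1 : retP W (PresentedGroup.of u : RAAG Γ) •
          ((1 : parabolic Γ W) : Cosets Γ W v) = (1 : parabolic Γ W) := by
        rw [smul_mk_eq_iff]
        by_cases hu : u ∈ W
        · have : ret W (PresentedGroup.of u : RAAG Γ) ∈ parabolic Γ (W ∩ Γ.neighborSet v) := by
            rw [ret_of_mem hu]
            exact ret_of_mem ⟨hu, h⟩
          simp only [OneMemClass.coe_one, inv_one, one_mul, mul_one]
          exact this
        · rw [retP_of_notMem hu]
          simp [one_mem]
      rw [Commute, SemiconjBy]
      ext
      · simp [act_of, h1]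
      · simp
    intro u u' h
    by_cases h1 : u = v
    · subst h1
      rw [if_pos rfl, if_neg h.ne']
      exact key _ h
    · by_cases h2 : u' = v
      · subst h2
        rw [if_pos rfl, if_neg h1]
        exact (key _ h.symm).symm
      · rw [if_neg h1, if_neg h2]
        exact ((commute_of_adj h).map (retP W)).map inr)

theorem split_of_self (W : Set V) (v : V) : split W v (PresentedGroup.of v : RAAG Γ) =
    inl (of ((1 : parabolic Γ W) : Cosets Γ W v)) := by
  rw [split, raagLift_of, if_pos rfl]

theorem split_of_ne {W : Set V} {u v : V} (h : u ≠ v) :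
    split W v (PresentedGroup.of u : RAAG Γ) = inr (retP W (PresentedGroup.of u)) := by
  rw [split, raagLift_of, if_neg h]

theorem split_of_mem {W : Set V} {v : V} (hv : v ∉ W) {a : RAAG Γ} (ha : a ∈ parabolic Γ W) :
    split W v a = inr ⟨a, ha⟩ := by
  have : (split W v).comp (ret W) = inr.comp (retP W : RAAG Γ →* parabolic Γ W) := by
    ext u : 1
    by_cases hu : u ∈ W
    · rw [MonoidHom.comp_apply, ret_of_mem hu, split_of_ne (by rintro rfl; exact hv hu)]
      rfl
    · rw [MonoidHom.comp_apply, MonoidHom.comp_apply, ret_of_notMem hu, retP_of_notMem hu,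
        _root_.map_one, _root_.map_one]
  have h1 := DFunLike.congr_fun this a
  rwa [MonoidHom.comp_apply, MonoidHom.comp_apply, mem_parabolic.mp ha, retP_of_mem ha] at h1

theorem split_right {W : Set V} {v : V} (hv : v ∉ W) (a : RAAG Γ) :
    (split W v a).right = retP W a := by
  have : rightHom.comp (split W v) = (retP W : RAAG Γ →* parabolic Γ W) := by
    ext u : 1
    by_cases hu : u = v
    · subst hu
      rw [MonoidHom.comp_apply, split_of_self, retP_of_notMem hv]
      simp
    · rw [MonoidHom.comp_apply, split_of_ne hu]
      simp
  exact DFunLike.congr_fun this a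

/-- The conjugates of the vertex `v` indexed by cosets. -/
noncomputable def conjVertex (W : Set V) (v : V) (x : Cosets Γ W v) : RAAG Γ :=
  Quotient.liftOn' x (fun b : parabolic Γ W =>
    (b : RAAG Γ) * (PresentedGroup.of v : RAAG Γ) * (b : RAAG Γ)⁻¹) (by
      intro b b' h
      have h1 : (b : RAAG Γ)⁻¹ * b' ∈ parabolic Γ (W ∩ Γ.neighborSet v) := by
        simpa [Subgroup.mem_subgroupOf] using QuotientGroup.leftRel_apply.mp h
      have h2 := (commute_of_mem_parabolic Set.inter_subset_right h1).eq
      change (b : RAAG Γ) * (PresentedGroup.of v : RAAG Γ) * (b : RAAG Γ)⁻¹ =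
        (b' : RAAG Γ) * (PresentedGroup.of v : RAAG Γ) * (b' : RAAG Γ)⁻¹
      calc _ = (b : RAAG Γ) * ((PresentedGroup.of v : RAAG Γ) * ((b : RAAG Γ)⁻¹ * b')) *
            (b' : RAAG Γ)⁻¹ := by group
        _ = _ := by rw [h2]; group)

theorem conjVertex_mk {W : Set V} {v : V} (g : parabolic Γ W) :
    conjVertex W v (g : Cosets Γ W v) =
      (g : RAAG Γ) * (PresentedGroup.of v : RAAG Γ) * (g : RAAG Γ)⁻¹ := rfl

theorem conjVertex_smul {W : Set V} {v : V} (b : parabolic Γ W) (x : Cosets Γ W v) :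
    conjVertex W v (b • x) = (b : RAAG Γ) * conjVertex W v x * (b : RAAG Γ)⁻¹ := by
  obtain ⟨g, rfl⟩ := QuotientGroup.mk_surjective x
  have h1 : b • (g : Cosets Γ W v) = ((b * g : parabolic Γ W) : Cosets Γ W v) := rfl
  rw [h1, conjVertex_mk, conjVertex_mk]
  push_cast
  group

/-- The map gluing back the vertex `v`. -/
noncomputable def glue (W : Set V) (v : V) : SD (parabolic Γ W) (Cosets Γ W v) →* RAAG Γ :=
  SemidirectProduct.lift (FreeGroup.lift (conjVertex W v)) (parabolic Γ W).subtype (by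
      intro b
      ext x
      simp only [MonoidHom.comp_apply, MulEquiv.coe_toMonoidHom, act_of, FreeGroup.lift_apply_of,
        conjVertex_smul]
      rfl)

theorem glue_split {W : Set V} {v : V} (hv : v ∉ W) (a : RAAG Γ) :
    glue W v (split W v a) = ret (insert v W) a := by
  have : (glue W v).comp (split W v) = (ret (insert v W) : RAAG Γ →* RAAG Γ) := by
    ext u
    by_cases hu : u = v
    · subst hu
      rw [MonoidHom.comp_apply, split_of_self, ret_of_mem (Set.mem_insert _ _), glue, lift_inl,
        FreeGroup.lift_apply_of]
      simp [conjVertex_mk]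
    · rw [MonoidHom.comp_apply, split_of_ne hu, glue, lift_inr]
      by_cases hu' : u ∈ W
      · rw [ret_of_mem (Set.mem_insert_of_mem _ hu')]
        exact ret_of_mem hu'
      · rw [retP_of_notMem hu', ret_of_notMem (by simp [hu, hu']), _root_.map_one]
  exact DFunLike.congr_fun this a

theorem split_injective {W : Set V} {v : V} (hv : v ∉ W) {a b : RAAG Γ}
    (ha : a ∈ parabolic Γ (insert v W)) (hb : b ∈ parabolic Γ (insert v W))
    (h : split W v a = split W v b) : a = b := by
  rw [← mem_parabolic.mp ha, ← mem_parabolic.mp hb, ← glue_split hv, ← glue_split hv, h]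

end

section
variable {V : Type*} {Γ : SimpleGraph V}

open SemidirectProduct in
open Classical in
theorem commute_iff_split {W : Set V} {v : V} (hv : v ∉ W) {c g : RAAG Γ}
    (hc : c ∈ parabolic Γ W) (hg : g ∈ parabolic Γ (insert v W)) :
    Commute c g ↔ (∀ x ∈ supp (split W v g).left, (⟨c, hc⟩ : parabolic Γ W) • x = x) ∧
      Commute c (ret W g) := by
  have hc' := parabolic_mono (Set.subset_insert v W) hc
  have h1 : Commute c g ↔ split W v (c * g) = split W v (g * c) :=
    ⟨fun h => congrArg _ h, fun h => split_injective hv (mul_mem hc' hg) (mul_mem hg hc') h⟩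
  rw [h1, ← act_eq_self_iff, _root_.map_mul, _root_.map_mul, split_of_mem hv hc,
    SemidirectProduct.ext_iff]
  simp only [mul_left, mul_right, left_inr, right_inr, one_mul, mul_one, _root_.map_one,
    split_right hv]
  refine and_congr Iff.rfl ?_
  rw [Subtype.ext_iff]
  exact Iff.rfl

variable (Γ) in
/-- Intersections of standard parabolic subgroups with conjugates of standard parabolic subgroups
are parabolic. -/
def ParabolicInter (W : Set V) : Prop := ∀ M ⊆ W, ∀ L ⊆ W, ∀ g ∈ parabolic Γ W,
  ∃ h ∈ parabolic Γ M, ∃ M' ⊆ M, ∀ a, (a ∈ parabolic Γ M ∧ g⁻¹ * a * g ∈ parabolic Γ L) ↔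
    h⁻¹ * a * h ∈ parabolic Γ M'

theorem ParabolicInter.list {W : Set V} (hW : ParabolicInter Γ W) {M : Set V} (hM : M ⊆ W)
    (l : List (Set V × RAAG Γ)) (hl : ∀ p ∈ l, p.1 ⊆ W ∧ p.2 ∈ parabolic Γ W) :
    ∃ h ∈ parabolic Γ M, ∃ M' ⊆ M, ∀ a,
      (a ∈ parabolic Γ M ∧ ∀ p ∈ l, p.2⁻¹ * a * p.2 ∈ parabolic Γ p.1) ↔
        h⁻¹ * a * h ∈ parabolic Γ M' := by
  induction l with
  | nil => exact ⟨1, one_mem _, M, subset_rfl, fun a => by simp⟩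
  | cons p l ih =>
    obtain ⟨h, hh, M', hM', H⟩ := ih fun q hq => hl q (List.mem_cons_of_mem _ hq)
    obtain ⟨hp1, hp2⟩ := hl p List.mem_cons_self
    obtain ⟨k, hk, M'', hM'', K⟩ := hW M' (hM'.trans hM) p.1 hp1 (h⁻¹ * p.2)
      (mul_mem (inv_mem (parabolic_mono hM hh)) hp2)
    refine ⟨h * k, mul_mem hh (parabolic_mono hM' hk), M'', hM''.trans hM', fun a => ?_⟩
    have e1 : (h * k)⁻¹ * a * (h * k) = k⁻¹ * (h⁻¹ * a * h) * k := by group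
    have e2 : (h⁻¹ * p.2)⁻¹ * (h⁻¹ * a * h) * (h⁻¹ * p.2) = p.2⁻¹ * a * p.2 := by group
    rw [e1, ← K, ← H, e2, List.forall_mem_cons]
    tauto

theorem exists_conj_of_commute {W M : Set V} (ih : ∀ W' ⊂ W, ParabolicInter Γ W') (hM : M ⊆ W)
    {g : RAAG Γ} (hg : g ∈ parabolic Γ W) (hg1 : ret M g = 1) :
    ∃ h ∈ parabolic Γ M, ∃ M' ⊆ M, ∀ a, (a ∈ parabolic Γ M ∧ Commute a g) ↔
      h⁻¹ * a * h ∈ parabolic Γ M' := by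
  classical
  rcases hM.eq_or_ssubset with rfl | hlt
  · rw [mem_parabolic.mp hg] at hg1
    exact ⟨1, one_mem _, M, subset_rfl, fun a => by simp [hg1]⟩
  obtain ⟨v, hvW, hvM⟩ := Set.exists_of_ssubset hlt
  set W' := W \ {v} with hW'
  have hv : v ∉ W' := fun h => h.2 rfl
  have hWW : insert v W' = W := Set.insert_sdiff_self_of_mem hvW
  have hMW : M ⊆ W' := fun x hx => ⟨hM hx, fun h => hvM (h ▸ hx)⟩
  have hss : W' ⊂ W := ⟨Set.sdiff_subset, fun h => hv (h hvW)⟩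
  have hb : ret M (ret W' g) = 1 := by rw [ret_ret, Set.inter_eq_left.mpr hMW, hg1]
  obtain ⟨h, hh, M', hM', H⟩ := (ih W' hss).list hMW ((M, ret W' g) ::
    (finite_supp (split W' v g).left).toFinset.toList.map
      fun x => (W' ∩ Γ.neighborSet v, ((Quotient.out x : parabolic Γ W') : RAAG Γ))) (by
      rw [List.forall_mem_cons, List.forall_mem_map]
      exact ⟨⟨hMW, ret_mem _ _⟩, fun x _ => ⟨Set.inter_subset_left, Subtype.prop _⟩⟩)
  refine ⟨h, hh, M', hM', fun a => ?_⟩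
  rw [← H, List.forall_mem_cons, List.forall_mem_map]
  refine and_congr_right fun ha => ?_
  rw [commute_iff_split hv (parabolic_mono hMW ha) (hWW ▸ hg), and_comm]
  refine and_congr ⟨fun hc => ?_, fun hc => ?_⟩ (forall_congr' fun x => ?_)
  · rw [mul_assoc, hc.eq, inv_mul_cancel_left]
    exact ha
  · rw [mem_parabolic, _root_.map_mul, _root_.map_mul, _root_.map_inv, hb,
      mem_parabolic.mp ha] at hc
    simp only [inv_one, one_mul, mul_one] at hc
    change a * _ = _ * a
    nth_rewrite 2 [hc]
    group
  · rw [Finset.mem_toList, Set.Finite.mem_toFinset]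
    refine imp_congr_right fun _ => ?_
    rw [← smul_mk_eq_iff (⟨a, parabolic_mono hMW ha⟩ : parabolic Γ W') (Quotient.out x),
      QuotientGroup.out_eq']

theorem parabolicInter [Finite V] (W : Set V) : ParabolicInter Γ W := by
  induction W using WellFoundedLT.induction with
  | ind W ih =>
  intro M hM L hL g hg
  have hMg := ret_mem M g
  set h0 := ret M g with hh0
  have hg1 : h0⁻¹ * g ∈ parabolic Γ W := mul_mem (inv_mem (parabolic_mono hM hMg)) hg
  set g1 := h0⁻¹ * g with hg1_def
  have hr : ret M g1 = 1 := by
    rw [hg1_def, _root_.map_mul, _root_.map_inv, mem_parabolic.mp hMg, ← hh0, inv_mul_cancel]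
  have hLg := ret_mem L g1
  set l := ret L g1 with hl
  have hr2 : ret (M ∩ L) (g1 * l⁻¹) = 1 := by
    rw [← ret_ret, _root_.map_mul (ret L), _root_.map_inv (ret L), mem_parabolic.mp hLg, ← hl,
      mul_inv_cancel, _root_.map_one]
  obtain ⟨k, hk, M', hM', K⟩ := exists_conj_of_commute ih (Set.inter_subset_left.trans hM)
    (mul_mem hg1 (inv_mem (parabolic_mono hL hLg))) hr2
  refine ⟨h0 * k, mul_mem hMg (parabolic_mono Set.inter_subset_left hk), M',
    hM'.trans Set.inter_subset_left, fun a => ?_⟩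
  have e1 : (h0 * k)⁻¹ * a * (h0 * k) = k⁻¹ * (h0⁻¹ * a * h0) * k := by group
  have e2 : g⁻¹ * a * g = g1⁻¹ * (h0⁻¹ * a * h0) * g1 := by rw [hg1_def]; group
  have e3 : a ∈ parabolic Γ M ↔ h0⁻¹ * a * h0 ∈ parabolic Γ M := by
    rw [Subgroup.mul_mem_cancel_right _ hMg, Subgroup.mul_mem_cancel_left _ (inv_mem hMg)]
  rw [e1, ← K, e2, e3]
  generalize h0⁻¹ * a * h0 = c
  constructor
  · rintro ⟨hc, hcL⟩
    have h1 : ret M (g1⁻¹ * c * g1) = c := by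
      rw [_root_.map_mul, _root_.map_mul, _root_.map_inv, hr, mem_parabolic.mp hc]
      group
    have h2 : c ∈ parabolic Γ (M ∩ L) := h1 ▸ ret_mem_inter hcL
    refine ⟨h2, ?_⟩
    have h3 := mem_parabolic.mp hcL
    rw [_root_.map_mul, _root_.map_mul, _root_.map_inv, ← hl,
      mem_parabolic.mp (parabolic_mono Set.inter_subset_right h2)] at h3
    have h4 : c = g1 * (l⁻¹ * c * l) * g1⁻¹ := by rw [h3]; group
    change c * (g1 * l⁻¹) = g1 * l⁻¹ * c
    nth_rewrite 1 [h4]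
    group
  · rintro ⟨hc, hcomm⟩
    refine ⟨parabolic_mono Set.inter_subset_left hc, ?_⟩
    have h1 : g1⁻¹ * c * g1 = l⁻¹ * c * l := by
      have h2 : c = (g1 * l⁻¹) * c * (g1 * l⁻¹)⁻¹ := by rw [← hcomm.eq]; group
      nth_rewrite 1 [h2]
      group
    rw [h1]
    exact mul_mem (mul_mem (inv_mem hLg) (parabolic_mono Set.inter_subset_right hc)) hLg

theorem finitelyFixed_cosets [Finite V] (W : Set V) (v : V) :
    FinitelyFixed (parabolic Γ W) (Cosets Γ W v) := by
  intro S
  let Q : Set V → Prop := fun M => M ⊆ W ∧ ∃ T ⊆ S, T.Finite ∧ ∃ h ∈ parabolic Γ W,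
    ∀ b : parabolic Γ W, (∀ x ∈ T, b • x = x) ↔ h⁻¹ * b * h ∈ parabolic Γ M
  have hQ : ∃ M, Q M := ⟨W, subset_rfl, ∅, Set.empty_subset _, Set.finite_empty, 1, one_mem _,
    fun b => by simp⟩
  obtain ⟨M, ⟨hM, T, hTS, hT, h, hh, H⟩, hmin⟩ := WellFounded.has_min
    (wellFounded_lt (α := Set V)) {M | Q M} hQ
  refine ⟨T, hTS, hT, fun b hb s hs => ?_⟩
  obtain ⟨g, rfl⟩ := QuotientGroup.mk_surjective s
  obtain ⟨k, hk, M', hM', K⟩ := parabolicInter (Γ := Γ) W M hM (W ∩ Γ.neighborSet v)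
    Set.inter_subset_left (h⁻¹ * g) (mul_mem (inv_mem hh) g.2)
  have K' : ∀ b : parabolic Γ W, (h⁻¹ * b * h ∈ parabolic Γ M ∧ b • (g : Cosets Γ W v) = g) ↔
      k⁻¹ * (h⁻¹ * b * h) * k ∈ parabolic Γ M' := by
    intro b
    have e2 : (h⁻¹ * g)⁻¹ * (h⁻¹ * b * h) * (h⁻¹ * g) = (g : RAAG Γ)⁻¹ * b * g := by group
    rw [← K, e2, smul_mk_eq_iff]
  have hQ' : Q M' := by
    refine ⟨hM'.trans hM, insert (g : Cosets Γ W v) T, Set.insert_subset hs hTS, hT.insert _,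
      h * k, mul_mem hh (parabolic_mono hM hk), fun b => ?_⟩
    have e1 : (h * k)⁻¹ * b * (h * k) = k⁻¹ * (h⁻¹ * b * h) * k := by group
    rw [e1, ← K', Set.forall_mem_insert, H, and_comm]
  have hMM : M' = M := by
    by_contra hne
    exact hmin M' hQ' (hM'.ssubset_of_ne hne)
  subst hMM
  have hb' := (H b).mp hb
  exact ((K' b).mpr (mul_mem (mul_mem (inv_mem hk) hb') hk)).2

end

theorem good_parabolic {V : Type u} [Finite V] (Γ : SimpleGraph V) (W : Set V) :
    Good (parabolic Γ W) := by
  induction W, W.toFinite using Set.Finite.induction_on with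
  | empty =>
    have : Subsingleton (parabolic Γ ∅) := ⟨fun a b => Subtype.ext <| by
      rw [eq_one_of_mem_parabolic_empty a.2, eq_one_of_mem_parabolic_empty b.2]⟩
    exact good_of_subsingleton _
  | @insert v W hv _ ih =>
    refine (Good.semidirect ih (rootClosed_cosets ih.1.torsionFree v)
      (finitelyFixed_cosets W v)).of_injective
      ((split W v).comp (parabolic Γ (insert v W)).subtype) ?_
    intro a b hab
    exact Subtype.ext (split_injective hv a.2 b.2 hab)

end RaagComm

/-- Every commensurating endomorphism of a non-abelian subgroup of a finitely
generated right-angled Artin group is an inner automorphism. -/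
theorem commensurating_endomorphism_of_raag_subgroup_is_inner
    {V : Type*} [Fintype V] (Γ : SimpleGraph V)
    (H : Subgroup (RAAG Γ)) (hna : ¬ ∀ a b : H, a * b = b * a)
    (φ : H →* H) (hφ : ∀ h : H, CommElem (φ h) h) :
    ∃ w : H, ∀ h : H, φ h = w * h * w⁻¹ := by
  have hH : ∀ h : H, (h : RAAG Γ) ∈ RaagComm.parabolic Γ Set.univ := fun h => by
    rw [RaagComm.parabolic_univ]
    exact Subgroup.mem_top _
  rcases (RaagComm.good_parabolic Γ Set.univ).2 H (H.subtype.codRestrict _ hH)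
    (fun a b hab => Subtype.ext (congrArg (fun x => x.val) hab)) with h | h
  · exact absurd (fun a b => (h a b).eq) hna
  · exact h φ hφ
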